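/- arXiv:2009.07677 — 2 statements merged into one kernel-verified Lean document; each statement's English description precedes it below -/
import Mathlib

section
/- Let ℓ ≥ 1 and let Λ = {a_1,…,a_ℓ} be a collection of sequences of positive integers which satisfies Condition (**) and is good for liminf-ℓ-recurrence. If a topological dynamical system (X,T) has positive topological entropy, then there exists a closed subset of X which is Δ-weakly mixing along Λ (indeed one may take it to be a Cantor set). -/
open MeasureTheory Filter Topology Set

/-- `E` is Δ-transitive along the collection `a` of sequences: there is a residual subset
`A` of `E` (in the subspace topology) such that for every `x ∈ A`,
`E^ℓ ⊆ closure {(T^{a₁(n)}x, …, T^{a_ℓ(n)}x) : n ∈ ℕ}`. -/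
def DeltaTransAlong {X : Type*} [TopologicalSpace X] {ℓ : ℕ} (T : X → X)
    (a : Fin ℓ → ℕ → ℕ) (E : Set X) : Prop :=
  ∃ A ∈ residual ↥E, ∀ x ∈ A,
    {y : Fin ℓ → X | ∀ i, y i ∈ E} ⊆
      closure {y : Fin ℓ → X | ∃ n : ℕ, 1 ≤ n ∧ y = fun i => T^[a i n] (x : X)}

/-- `E` is Δ-weakly mixing along the collection `a` of sequences: for every `m ∈ ℕ`, the set
`E^m` is a Δ-transitive subset of the product system `(X^m, T × ⋯ × T)` along `a`. -/
def DeltaWeakMixAlong {X : Type*} [TopologicalSpace X] {ℓ : ℕ} (T : X → X)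
    (a : Fin ℓ → ℕ → ℕ) (E : Set X) : Prop :=
  ∀ m : ℕ, 1 ≤ m →
    DeltaTransAlong (fun y : Fin m → X => T ∘ y) a {y : Fin m → X | ∀ j, y j ∈ E}

/-- Condition (*) for a sequence of integers. -/
def CondStar (a : ℕ → ℕ) : Prop :=
  ∀ L : ℕ, 0 < L →
    Tendsto (fun N : ℕ =>
      ((((Finset.Icc 1 N) ×ˢ (Finset.Icc 1 N)).filter
        (fun p => |(a p.1 : ℤ) - (a p.2 : ℤ)| ≤ (L : ℤ))).card : ℝ) / (N : ℝ) ^ 2)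
      atTop (𝓝 0)

/-- Condition (**) for a collection of sequences. -/
def CondStarStar {ℓ : ℕ} (a : Fin ℓ → ℕ → ℕ) : Prop :=
  (∀ i, CondStar (a i)) ∧
  ∀ (i : ℕ) (h : i + 1 < ℓ),
    Tendsto (fun n => (a ⟨i + 1, h⟩ n : ℤ) - (a ⟨i, Nat.lt_of_succ_lt h⟩ n : ℤ))
      atTop atTop

/-- The collection `a` of sequences is good for liminf-ℓ-recurrence: for every invertible
measure preserving system on a standard Borel probability space and every measurable set `A`
of positive measure, `liminf_N (1/N) Σ_{n=1}^N ν(A ∩ S^{-a₁(n)}A ∩ ⋯ ∩ S^{-a_ℓ(n)}A) > 0`. -/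
def GoodLiminfRecurrence {ℓ : ℕ} (a : Fin ℓ → ℕ → ℕ) : Prop :=
  ∀ (Y : Type) [MeasurableSpace Y] [StandardBorelSpace Y]
    (ν : MeasureTheory.Measure Y) [IsProbabilityMeasure ν] (S : Y ≃ᵐ Y),
    MeasurePreserving S ν ν → ∀ A : Set Y, MeasurableSet A → 0 < ν A →
    0 < Filter.atTop.liminf (fun N : ℕ =>
      (1 / N : ℝ) * ∑ n ∈ Finset.Icc 1 N,
        (ν (A ∩ ⋂ i : Fin ℓ, (⇑S)^[a i n] ⁻¹' A)).toReal)

/-- A Cantor set: a non-empty compact perfect totally disconnected set. -/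
def IsCantorSet {X : Type*} [TopologicalSpace X] (C : Set X) : Prop :=
  C.Nonempty ∧ IsCompact C ∧ Perfect C ∧ IsTotallyDisconnected C

theorem exists_mem_card_ge_of_weight {u ρ : ℝ} (hu : 0 < u) (hρ : 1 < ρ) :
    ∃ γ : ℝ, 0 < γ ∧ ∀ (α : Type*) (D : Finset α) (F : Finset (Finset α)),
      (∀ e ∈ F, e ⊆ D) → ρ ^ D.card ≤ ∑ e ∈ F, u ^ e.card →
      ∃ e ∈ F, γ * D.card ≤ e.card := by
  obtain ⟨θ, hθ0, hθ⟩ : ∃ θ : ℝ, 0 < θ ∧ 1 + θ * u < ρ :=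
    ⟨(ρ - 1) / (2 * u), div_pos (by linarith) (by linarith), by
      have : (ρ - 1) / (2 * u) * u = (ρ - 1) / 2 := by field_simp
      rw [this]; linarith⟩
  have hb : 0 < 1 + θ * u := by positivity
  set s : ℝ := ρ / (1 + θ * u) with hs
  have hs1 : 1 < s := (one_lt_div hb).2 hθ
  obtain ⟨K, hK⟩ : ∃ K : ℕ, 1 / θ < s ^ K := pow_unbounded_of_one_lt _ hs1
  have hK' : 1 ≤ θ * s ^ K := by
    rw [div_lt_iff₀ hθ0] at hK; linarith
  refine ⟨1 / (K + 1), by positivity, fun α D F hF hle => ?_⟩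
  by_contra! hcon
  have hne : F.Nonempty := by
    rw [Finset.nonempty_iff_ne_empty]
    rintro rfl
    have : 0 < ρ ^ D.card := by positivity
    simp at hle; linarith
  have key : ∀ e ∈ F, u ^ e.card < s ^ D.card * (θ * u) ^ e.card := by
    intro e he
    have h1 := hcon e he
    have h2 : e.card * (K + 1) < D.card := by
      rw [one_div, inv_mul_eq_div, lt_div_iff₀ (by positivity)] at h1
      exact_mod_cast h1
    have h3 : 1 < s ^ D.card * θ ^ e.card := by
      obtain ⟨m, hm⟩ : ∃ m, D.card = e.card * K + m + 1 :=
        ⟨D.card - e.card * K - 1, by have : e.card * (K+1) = e.card * K + e.card := by ring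
                                     omega⟩
      have : s ^ D.card * θ ^ e.card = (θ * s ^ K) ^ e.card * s ^ (m + 1) := by
        rw [hm, mul_pow, ← pow_mul]; ring
      rw [this]
      exact one_lt_mul_of_le_of_lt (one_le_pow₀ hK') (one_lt_pow₀ hs1 (by omega))
    calc u ^ e.card = 1 * u ^ e.card := by ring
      _ < (s ^ D.card * θ ^ e.card) * u ^ e.card := by gcongr
      _ = _ := by rw [mul_pow]; ring
  have h4 : ∑ e ∈ F, u ^ e.card < ρ ^ D.card := by
    calc ∑ e ∈ F, u ^ e.card < ∑ e ∈ F, s ^ D.card * (θ * u) ^ e.card :=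
          Finset.sum_lt_sum_of_nonempty hne key
      _ ≤ ∑ e ∈ D.powerset, s ^ D.card * (θ * u) ^ e.card :=
          Finset.sum_le_sum_of_subset_of_nonneg
            (fun e he => Finset.mem_powerset.2 (hF e he)) (fun _ _ _ => by positivity)
      _ = s ^ D.card * (1 + θ * u) ^ D.card := by
          rw [← Finset.mul_sum]
          have := Finset.sum_pow_mul_eq_add_pow (θ * u) 1 D
          simp only [one_pow, mul_one] at this
          rw [this, add_comm]
      _ = ρ ^ D.card := by rw [← mul_pow, hs, div_mul_cancel₀ _ hb.ne']
  linarith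

/-- The finite set `S` realises every `P`/`Q` pattern on the coordinates in `J`. -/
def RealizesAll {Ω C : Type*} (P Q : C → Set Ω) (S : Finset Ω) (J : Finset C) : Prop :=
  ∀ τ : C → Bool, ∃ x ∈ S, ∀ c ∈ J, if τ c then x ∈ P c else x ∈ Q c

open Classical in
theorem card_le_card_realizesAll_pow {Ω C : Type*} {P Q : C → Set Ω}
    (hPQ : ∀ c, Disjoint (P c) (Q c)) {D : Finset C} (hD : D.Nonempty) {η : ℝ} {K : ℕ}
    (hη : 4 ≤ η * 4 ^ K) (S : Finset Ω)
    (hS : ∀ x ∈ S, ∀ y ∈ S, x ≠ y →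
      η * D.card ≤ (D.filter fun c => x ∈ P c ∧ y ∈ Q c ∨ x ∈ Q c ∧ y ∈ P c).card) :
    S.card ≤ (D.powerset.filter (RealizesAll P Q S)).card ^ K := by
  induction hn : S.card using Nat.strong_induction_on generalizing S with
  | _ n ih =>
  subst hn
  have hη0 : 0 < η := by
    by_contra! h
    have : η * 4 ^ K ≤ 0 := mul_nonpos_of_nonpos_of_nonneg h (by positivity)
    linarith
  rcases Nat.lt_or_ge S.card 2 with h2 | h2
  · rcases Nat.eq_zero_or_pos S.card with h0 | h0
    · rw [h0]; exact Nat.zero_le _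
    · have h1 : S.card = 1 := by omega
      rw [h1]
      apply Nat.one_le_pow
      apply Finset.card_pos.2
      obtain ⟨x, hx⟩ := Finset.card_pos.1 h0
      exact ⟨∅, by simpa [RealizesAll] using ⟨x, hx⟩⟩
  have hDpos : (0 : ℝ) < D.card := by exact_mod_cast hD.card_pos
  obtain ⟨c, hcD, hc⟩ : ∃ c ∈ D, η * (S.card * (S.card - 1)) ≤
      2 * ((S.filter (· ∈ P c)).card * (S.filter (· ∈ Q c)).card : ℝ) := by
    by_contra! hcon
    have h1 : ∑ p ∈ S.offDiag, η * (D.card : ℝ) ≤ ∑ p ∈ S.offDiag,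
        ((D.filter fun c => p.1 ∈ P c ∧ p.2 ∈ Q c ∨ p.1 ∈ Q c ∧ p.2 ∈ P c).card : ℝ) := by
      refine Finset.sum_le_sum fun p hp => ?_
      rw [Finset.mem_offDiag] at hp
      exact hS _ hp.1 _ hp.2.1 hp.2.2
    have h2 : ∑ p ∈ S.offDiag,
        (D.filter fun c => p.1 ∈ P c ∧ p.2 ∈ Q c ∨ p.1 ∈ Q c ∧ p.2 ∈ P c).card
        = ∑ c ∈ D, (S.offDiag.filter
          fun p => p.1 ∈ P c ∧ p.2 ∈ Q c ∨ p.1 ∈ Q c ∧ p.2 ∈ P c).card :=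
      Finset.sum_card_bipartiteAbove_eq_sum_card_bipartiteBelow _
    have h3 : ∀ c ∈ D, (S.offDiag.filter
          fun p => p.1 ∈ P c ∧ p.2 ∈ Q c ∨ p.1 ∈ Q c ∧ p.2 ∈ P c).card ≤
        2 * ((S.filter (· ∈ P c)).card * (S.filter (· ∈ Q c)).card) := by
      intro c _
      have : (S.offDiag.filter
          fun p => p.1 ∈ P c ∧ p.2 ∈ Q c ∨ p.1 ∈ Q c ∧ p.2 ∈ P c) ⊆
          (S.filter (· ∈ P c)) ×ˢ (S.filter (· ∈ Q c)) ∪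
          (S.filter (· ∈ Q c)) ×ˢ (S.filter (· ∈ P c)) := by
        intro p hp
        simp only [Finset.mem_filter, Finset.mem_offDiag, Finset.mem_union,
          Finset.mem_product] at hp ⊢
        tauto
      refine (Finset.card_le_card this).trans ((Finset.card_union_le _ _).trans ?_)
      rw [Finset.card_product, Finset.card_product]
      exact le_of_eq (by ring)
    have h4 : ∑ c ∈ D, 2 * ((S.filter (· ∈ P c)).card * (S.filter (· ∈ Q c)).card : ℝ) <
        ∑ c ∈ D, η * (S.card * (S.card - 1)) := Finset.sum_lt_sum_of_nonempty hD hcon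
    have h5 : (∑ c ∈ D, (S.offDiag.filter
          fun p => p.1 ∈ P c ∧ p.2 ∈ Q c ∨ p.1 ∈ Q c ∧ p.2 ∈ P c).card : ℝ) ≤
        ∑ c ∈ D, 2 * ((S.filter (· ∈ P c)).card * (S.filter (· ∈ Q c)).card : ℝ) :=
      Finset.sum_le_sum fun c hc => by exact_mod_cast h3 c hc
    have h6 : (∑ p ∈ S.offDiag,
        ((D.filter fun c => p.1 ∈ P c ∧ p.2 ∈ Q c ∨ p.1 ∈ Q c ∧ p.2 ∈ P c).card : ℝ))
        = ∑ c ∈ D, ((S.offDiag.filter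
          fun p => p.1 ∈ P c ∧ p.2 ∈ Q c ∨ p.1 ∈ Q c ∧ p.2 ∈ P c).card : ℝ) := by
      exact_mod_cast h2
    rw [h6] at h1
    simp only [Finset.sum_const, Finset.offDiag_card, nsmul_eq_mul] at h1 h4
    have h7 : ((S.card * S.card - S.card : ℕ) : ℝ) = S.card * (S.card - 1) := by
      rw [Nat.cast_sub (by nlinarith)]; push_cast; ring
    rw [h7] at h1
    have : (D.card : ℝ) * (η * (S.card * (S.card - 1))) =
      S.card * (S.card - 1) * (η * D.card) := by ring
    linarith
  set S₁ := S.filter (· ∈ P c)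
  set S₂ := S.filter (· ∈ Q c)
  have hS2 : (2 : ℝ) ≤ S.card := by exact_mod_cast h2
  have hpos : 0 < (S₁.card * S₂.card : ℝ) := by
    have : 0 < η * (S.card * (S.card - 1)) := by
      apply mul_pos hη0; apply mul_pos <;> linarith
    linarith
  have hp1 : 0 < S₁.card := by
    rcases Nat.eq_zero_or_pos S₁.card with h | h
    · simp [h] at hpos
    · exact h
  have hp2 : 0 < S₂.card := by
    rcases Nat.eq_zero_or_pos S₂.card with h | h
    · simp [h] at hpos
    · exact h
  have hdisj : Disjoint S₁ S₂ := by
    rw [Finset.disjoint_left]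
    intro x h1 h2
    exact Set.disjoint_left.1 (hPQ c) (Finset.mem_filter.1 h1).2 (Finset.mem_filter.1 h2).2
  have hsum : S₁.card + S₂.card ≤ S.card := by
    rw [← Finset.card_union_of_disjoint hdisj]
    exact Finset.card_le_card
      (Finset.union_subset (Finset.filter_subset _ _) (Finset.filter_subset _ _))
  have i1 := ih S₁.card (by omega) S₁ (fun x hx y hy => hS x (Finset.mem_filter.1 hx).1 y
    (Finset.mem_filter.1 hy).1) rfl
  have i2 := ih S₂.card (by omega) S₂ (fun x hx y hy => hS x (Finset.mem_filter.1 hx).1 y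
    (Finset.mem_filter.1 hy).1) rfl
  set F := D.powerset.filter (RealizesAll P Q S)
  set F₁ := D.powerset.filter (RealizesAll P Q S₁)
  set F₂ := D.powerset.filter (RealizesAll P Q S₂)
  have hc1 : ∀ J ∈ F₁, c ∉ J := by
    intro J hJ hcJ
    obtain ⟨x, hx, h⟩ := (Finset.mem_filter.1 hJ).2 (fun _ => false)
    have := h c hcJ
    simp only [Bool.false_eq_true, if_false] at this
    exact Set.disjoint_left.1 (hPQ c) (Finset.mem_filter.1 hx).2 this
  have hF : F₁.card + F₂.card ≤ F.card := by
    have hA : (F₁ ∪ F₂) ∪ (F₁ ∩ F₂).image (insert c) ⊆ F := by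
      intro J hJ
      simp only [Finset.mem_union, Finset.mem_image, Finset.mem_inter] at hJ
      simp only [F, Finset.mem_filter]
      rcases hJ with (h | h) | ⟨J', ⟨h1, h2⟩, rfl⟩
      · refine ⟨(Finset.mem_filter.1 h).1, fun τ => ?_⟩
        obtain ⟨x, hx, h⟩ := (Finset.mem_filter.1 h).2 τ
        exact ⟨x, (Finset.mem_filter.1 hx).1, h⟩
      · refine ⟨(Finset.mem_filter.1 h).1, fun τ => ?_⟩
        obtain ⟨x, hx, h⟩ := (Finset.mem_filter.1 h).2 τ
        exact ⟨x, (Finset.mem_filter.1 hx).1, h⟩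
      · have hJD := Finset.mem_powerset.1 (Finset.mem_filter.1 h1).1
        refine ⟨Finset.mem_powerset.2 (Finset.insert_subset hcD hJD), fun τ => ?_⟩
        by_cases hτ : τ c = true
        · obtain ⟨x, hx, h⟩ := (Finset.mem_filter.1 h1).2 τ
          refine ⟨x, (Finset.mem_filter.1 hx).1, fun d hd => ?_⟩
          rcases Finset.mem_insert.1 hd with rfl | hd
          · rw [if_pos hτ]; exact (Finset.mem_filter.1 hx).2
          · exact h d hd
        · obtain ⟨x, hx, h⟩ := (Finset.mem_filter.1 h2).2 τ
          refine ⟨x, (Finset.mem_filter.1 hx).1, fun d hd => ?_⟩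
          rcases Finset.mem_insert.1 hd with rfl | hd
          · rw [if_neg hτ]; exact (Finset.mem_filter.1 hx).2
          · exact h d hd
    have hc2 : ∀ J ∈ F₂, c ∉ J := by
      intro J hJ hcJ
      obtain ⟨x, hx, h⟩ := (Finset.mem_filter.1 hJ).2 (fun _ => true)
      have := h c hcJ
      simp only [if_true] at this
      exact Set.disjoint_left.1 (hPQ c) this (Finset.mem_filter.1 hx).2
    have hdj : Disjoint (F₁ ∪ F₂) ((F₁ ∩ F₂).image (insert c)) := by
      rw [Finset.disjoint_left]
      intro J hJ hJ'
      obtain ⟨J', _, rfl⟩ := Finset.mem_image.1 hJ'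
      rcases Finset.mem_union.1 hJ with h | h
      · exact hc1 _ h (Finset.mem_insert_self _ _)
      · exact hc2 _ h (Finset.mem_insert_self _ _)
    have hinj : ((F₁ ∩ F₂).image (insert c)).card = (F₁ ∩ F₂).card := by
      apply Finset.card_image_of_injOn
      intro J hJ J' hJ' h
      have a1 := hc1 J (Finset.mem_inter.1 hJ).1
      have a2 := hc1 J' (Finset.mem_inter.1 hJ').1
      rw [← Finset.erase_insert a1, ← Finset.erase_insert a2]
      exact congrArg (fun s => Finset.erase s c) h
    have := Finset.card_le_card hA
    rw [Finset.card_union_of_disjoint hdj, hinj, Finset.card_union_add_card_inter] at this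
    exact this
  have i1' : (S₁.card : ℝ) ≤ (F₁.card : ℝ) ^ K := by exact_mod_cast i1
  have i2' : (S₂.card : ℝ) ≤ (F₂.card : ℝ) ^ K := by exact_mod_cast i2
  have hfin : (S.card : ℝ) ^ 2 ≤ ((F.card : ℝ) ^ K) ^ 2 := by
    have e1 : (S.card : ℝ) ^ 2 ≤ 2 * (S.card * (S.card - 1)) := by nlinarith
    have e2 : η * (S.card : ℝ) ^ 2 ≤ 4 * (S₁.card * S₂.card) := by nlinarith
    have e3 : (S₁.card * S₂.card : ℝ) ≤ (F₁.card * F₂.card : ℝ) ^ K := by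
      rw [mul_pow]; gcongr
    have e4 : (4 * (F₁.card * F₂.card) : ℝ) ≤ (F.card : ℝ) ^ 2 := by
      have : (F₁.card + F₂.card : ℝ) ≤ F.card := by exact_mod_cast hF
      calc (4 * (F₁.card * F₂.card) : ℝ) ≤ (F₁.card + F₂.card : ℝ) ^ 2 := by
            nlinarith [sq_nonneg (F₁.card - F₂.card : ℝ)]
        _ ≤ _ := by gcongr
    have e5 : (4 : ℝ) ^ K * (F₁.card * F₂.card : ℝ) ^ K ≤ ((F.card : ℝ) ^ K) ^ 2 := by
      rw [← mul_pow, ← pow_mul, mul_comm K 2, pow_mul]; gcongr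
    have e6 : 4 * (S.card : ℝ) ^ 2 ≤ η * 4 ^ K * (S.card : ℝ) ^ 2 := by gcongr
    have e7 : η * 4 ^ K * (S.card : ℝ) ^ 2 ≤ 4 ^ K * (4 * (S₁.card * S₂.card)) := by
      calc η * 4 ^ K * (S.card : ℝ) ^ 2 = 4 ^ K * (η * (S.card : ℝ) ^ 2) := by ring
        _ ≤ _ := by gcongr
    have e8 : (4:ℝ) ^ K * (4 * (S₁.card * S₂.card)) ≤ 4 * ((F.card : ℝ) ^ K) ^ 2 := by
      calc (4:ℝ) ^ K * (4 * (S₁.card * S₂.card)) = 4 * (4 ^ K * (S₁.card * S₂.card)) := by ring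
        _ ≤ 4 * (4 ^ K * (F₁.card * F₂.card : ℝ) ^ K) := by gcongr
        _ ≤ _ := by gcongr
    linarith
  have := (pow_le_pow_iff_left₀ (by positivity) (by positivity) two_ne_zero).1 hfin
  exact_mod_cast this

/-- The set `S` of `ι`-valued words, with a colouring `g` of the letters `j₀`, realises every
pattern of `ι`-letters on the coordinates occurring in `e`, with each letter `j₀` at `t` carrying
the colour prescribed by `e`. -/
def RealizesColored {C ι R : Type*} (j₀ : ι) (g : (C → ι) → C → R) (S : Finset (C → ι))
    (e : Finset (C × R)) : Prop :=
  ∀ τ : C → ι, ∃ σ ∈ S, ∀ p ∈ e, σ p.1 = τ p.1 ∧ (τ p.1 = j₀ → g σ p.1 = p.2)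

open Classical in
theorem sum_colored_weight_le {C ι R : Type*} [Fintype ι] [Fintype R] (hR : 0 < Fintype.card R)
    (j₀ : ι) (g : (C → ι) → C → R) {q : ℝ} (hq : 0 < q) (hq' : (Fintype.card ι : ℝ) - 1 ≤ q)
    (Z : Finset C) (S : Finset (C → ι))
    (hS : ∀ σ ∈ S, ∀ τ ∈ S, (∀ t ∈ Z, σ t = τ t) → σ = τ) :
    ∑ σ ∈ S, ((Fintype.card R : ℝ)⁻¹) ^ (Z.filter fun t => σ t = j₀).card ≤
      q ^ Z.card * ∑ e ∈ (Z ×ˢ (Finset.univ : Finset R)).powerset.filter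
        (RealizesColored j₀ g S), (q⁻¹) ^ e.card := by
  induction Z using Finset.induction_on generalizing S with
  | empty =>
    rcases S.eq_empty_or_nonempty with rfl | ⟨σ₀, h₀⟩
    · simp only [Finset.sum_empty]; positivity
    · have hS1 : S = {σ₀} := by
        ext τ
        rw [Finset.mem_singleton]
        constructor
        · intro h; exact hS _ h _ h₀ (by simp)
        · rintro rfl; exact h₀
      subst hS1
      have : (((∅ : Finset C) ×ˢ (Finset.univ : Finset R)).powerset.filter
        (RealizesColored j₀ g {σ₀})) = {∅} := by
        ext e
        simp only [Finset.empty_product, Finset.powerset_empty, Finset.mem_filter,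
          Finset.mem_singleton]
        constructor
        · exact fun h => h.1
        · rintro rfl; exact ⟨rfl, fun τ => ⟨σ₀, by simp⟩⟩
      rw [this]; simp
  | insert t Z ht ih =>
    set r : ℝ := (Fintype.card R : ℝ) with hr
    have hr0 : 0 < r := by rw [hr]; exact_mod_cast hR
    let w (σ : C → ι) : ℝ := (r⁻¹) ^ (Z.filter fun t => σ t = j₀).card
    let F (S : Finset (C → ι)) := (Z ×ˢ (Finset.univ : Finset R)).powerset.filter
        (RealizesColored j₀ g S)
    let W (S : Finset (C → ι)) : ℝ := ∑ e ∈ F S, (q⁻¹) ^ e.card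
    let A (j : ι) := S.filter fun σ => σ t = j
    let B (c : R) := S.filter fun σ => σ t = j₀ ∧ g σ t = c
    have hA : ∀ j, ∑ σ ∈ A j, w σ ≤ q ^ Z.card * W (A j) := fun j =>
      ih (A j) fun σ hσ τ hτ h => hS σ (Finset.mem_filter.1 hσ).1 τ (Finset.mem_filter.1 hτ).1
        fun s hs => by
          rcases Finset.mem_insert.1 hs with rfl | hs
          · rw [(Finset.mem_filter.1 hσ).2, (Finset.mem_filter.1 hτ).2]
          · exact h s hs
    have hB : ∀ c, ∑ σ ∈ B c, w σ ≤ q ^ Z.card * W (B c) := fun c =>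
      ih (B c) fun σ hσ τ hτ h => hS σ (Finset.mem_filter.1 hσ).1 τ (Finset.mem_filter.1 hτ).1
        fun s hs => by
          rcases Finset.mem_insert.1 hs with rfl | hs
          · rw [(Finset.mem_filter.1 hσ).2.1, (Finset.mem_filter.1 hτ).2.1]
          · exact h s hs
    have hsplit : ∑ σ ∈ S, (r⁻¹) ^ ((insert t Z).filter fun t => σ t = j₀).card
        = ∑ j ∈ Finset.univ.erase j₀, ∑ σ ∈ A j, w σ + r⁻¹ * ∑ c, ∑ σ ∈ B c, w σ := by
      have h1 : ∑ σ ∈ S, (r⁻¹) ^ ((insert t Z).filter fun t => σ t = j₀).card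
          = ∑ j, ∑ σ ∈ A j, (r⁻¹) ^ ((insert t Z).filter fun t => σ t = j₀).card :=
        (Finset.sum_fiberwise _ _ _).symm
      rw [h1, ← Finset.sum_erase_add _ _ (Finset.mem_univ j₀)]
      congr 1
      · refine Finset.sum_congr rfl fun j hj => Finset.sum_congr rfl fun σ hσ => ?_
        have : σ t ≠ j₀ := by
          rw [(Finset.mem_filter.1 hσ).2]; exact (Finset.mem_erase.1 hj).1
        rw [Finset.filter_insert, if_neg this]
      · have h2 : ∑ σ ∈ A j₀, w σ = ∑ c, ∑ σ ∈ B c, w σ := by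
          rw [← Finset.sum_fiberwise (A j₀) (fun σ => g σ t)]
          refine Finset.sum_congr rfl fun c _ => Finset.sum_congr ?_ fun _ _ => rfl
          simp only [A, B, Finset.filter_filter]
        rw [← h2, Finset.mul_sum]
        refine Finset.sum_congr rfl fun σ hσ => ?_
        rw [Finset.filter_insert, if_pos (Finset.mem_filter.1 hσ).2,
          Finset.card_insert_of_notMem (fun h => ht (Finset.mem_filter.1 h).1), pow_succ']
    rw [hsplit]
    have hqi : 0 < q⁻¹ := inv_pos.2 hq
    -- the realised patterns of the whole set
    set G := ((insert t Z) ×ˢ (Finset.univ : Finset R)).powerset.filter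
        (RealizesColored j₀ g S) with hG
    have hsub : ∀ S' ⊆ S, F S' ⊆ F S := by
      intro S' h e he
      simp only [F, Finset.mem_filter] at he ⊢
      refine ⟨he.1, fun τ => ?_⟩
      obtain ⟨σ, hσ, h'⟩ := he.2 τ
      exact ⟨σ, h hσ, h'⟩
    let J := (F S) ×ˢ (Finset.univ : Finset R)
    let J' := J.filter fun p => p.1 ∈ F (B p.2) ∧ ∀ j ≠ j₀, p.1 ∈ F (A j)
    have hnot : ∀ e ∈ F S, ∀ c, (t, c) ∉ e := by
      intro e he c hc
      have := Finset.mem_powerset.1 (Finset.mem_filter.1 he).1 hc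
      exact ht (Finset.mem_product.1 this).1
    have hGsub : F S ∪ J'.image (fun p => insert (t, p.2) p.1) ⊆ G := by
      intro e he
      rcases Finset.mem_union.1 he with he | he
      · simp only [F, hG, Finset.mem_filter, Finset.mem_powerset] at he ⊢
        refine ⟨he.1.trans ?_, he.2⟩
        exact Finset.product_subset_product_left (Finset.subset_insert _ _)
      · obtain ⟨⟨e', c⟩, hp, rfl⟩ := Finset.mem_image.1 he
        simp only [J', J, Finset.mem_filter, Finset.mem_product, Finset.mem_univ, and_true] at hp
        obtain ⟨h1, h2, h3⟩ := hp
        simp only [hG, Finset.mem_filter, Finset.mem_powerset]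
        refine ⟨Finset.insert_subset (by simp) ?_, fun τ => ?_⟩
        · exact (Finset.mem_powerset.1 (Finset.mem_filter.1 h1).1).trans
            (Finset.product_subset_product_left (Finset.subset_insert _ _))
        · by_cases hτ : τ t = j₀
          · obtain ⟨σ, hσ, h⟩ := (Finset.mem_filter.1 h2).2 τ
            simp only [B, Finset.mem_filter] at hσ
            refine ⟨σ, hσ.1, fun p hp => ?_⟩
            rcases Finset.mem_insert.1 hp with rfl | hp
            · exact ⟨hσ.2.1.trans hτ.symm, fun _ => hσ.2.2⟩
            · exact h p hp
          · obtain ⟨σ, hσ, h⟩ := (Finset.mem_filter.1 (h3 _ hτ)).2 τ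
            simp only [A, Finset.mem_filter] at hσ
            refine ⟨σ, hσ.1, fun p hp => ?_⟩
            rcases Finset.mem_insert.1 hp with rfl | hp
            · exact ⟨hσ.2, fun h => absurd h hτ⟩
            · exact h p hp
    have hdisj : Disjoint (F S) (J'.image (fun p => insert (t, p.2) p.1)) := by
      rw [Finset.disjoint_left]
      intro e he he'
      obtain ⟨p, _, rfl⟩ := Finset.mem_image.1 he'
      exact hnot _ he p.2 (Finset.mem_insert_self _ _)
    have hJ'mem : ∀ p ∈ J', p.1 ∈ F S := fun p hp =>
      (Finset.mem_product.1 (Finset.mem_filter.1 hp).1).1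
    have hinj : Set.InjOn (fun p : Finset (C × R) × R => insert (t, p.2) p.1) J' := by
      rintro ⟨e, c⟩ hp ⟨e', c'⟩ hp' h
      have h1 := hnot e (hJ'mem _ hp)
      have h2 := hnot e' (hJ'mem _ hp')
      simp only at h
      have hcc : c = c' := by
        have : (t, c) ∈ insert (t, c') e' := h ▸ Finset.mem_insert_self _ _
        rcases Finset.mem_insert.1 this with h | h
        · exact (Prod.mk.inj h).2
        · exact absurd h (h2 c)
      subst hcc
      have : e = e' := by
        rw [← Finset.erase_insert (h1 c), ← Finset.erase_insert (h2 c), h]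
      rw [this]
    have hGW : q * W S + ∑ p ∈ J', (q⁻¹) ^ p.1.card ≤ q * ∑ e ∈ G, (q⁻¹) ^ e.card := by
      have h1 : ∑ e ∈ F S ∪ J'.image (fun p => insert (t, p.2) p.1), (q⁻¹) ^ e.card ≤
          ∑ e ∈ G, (q⁻¹) ^ e.card :=
        Finset.sum_le_sum_of_subset_of_nonneg hGsub fun _ _ _ => by positivity
      rw [Finset.sum_union hdisj, Finset.sum_image hinj] at h1
      have h2 : ∑ p ∈ J', (q⁻¹) ^ (insert (t, p.2) p.1).card
          = q⁻¹ * ∑ p ∈ J', (q⁻¹) ^ p.1.card := by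
        rw [Finset.mul_sum]
        refine Finset.sum_congr rfl fun p hp => ?_
        rw [Finset.card_insert_of_notMem (hnot _ (hJ'mem _ hp) _), pow_succ']
      rw [h2] at h1
      have h3 := mul_le_mul_of_nonneg_left h1 hq.le
      rw [mul_add, ← mul_assoc, mul_inv_cancel₀ hq.ne', one_mul] at h3
      exact h3
    have hW : ∑ j ∈ Finset.univ.erase j₀, W (A j) + r⁻¹ * ∑ c, W (B c) ≤
        q * W S + ∑ p ∈ J', (q⁻¹) ^ p.1.card := by
      have hind : ∀ S' ⊆ S, W S' = ∑ e ∈ F S, if e ∈ F S' then (q⁻¹) ^ e.card else 0 := by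
        intro S' h
        rw [← Finset.sum_filter]
        exact Finset.sum_congr (Finset.ext fun e =>
          ⟨fun h' => Finset.mem_filter.2 ⟨hsub _ h h', h'⟩, fun h' => (Finset.mem_filter.1 h').2⟩)
          fun _ _ => rfl
      have e1 : ∑ j ∈ Finset.univ.erase j₀, W (A j) = ∑ e ∈ F S, (q⁻¹) ^ e.card *
          ∑ j ∈ Finset.univ.erase j₀, if e ∈ F (A j) then 1 else 0 := by
        rw [Finset.sum_congr rfl fun j _ => hind (A j) (Finset.filter_subset _ _),
          Finset.sum_comm]
        refine Finset.sum_congr rfl fun e _ => ?_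
        rw [Finset.mul_sum]
        exact Finset.sum_congr rfl fun j _ => by rw [mul_ite, mul_one, mul_zero]
      have e2 : ∑ c, W (B c) = ∑ e ∈ F S, (q⁻¹) ^ e.card *
          ∑ c, if e ∈ F (B c) then 1 else 0 := by
        rw [Finset.sum_congr rfl fun c _ => hind (B c) (Finset.filter_subset _ _),
          Finset.sum_comm]
        refine Finset.sum_congr rfl fun e _ => ?_
        rw [Finset.mul_sum]
        exact Finset.sum_congr rfl fun j _ => by rw [mul_ite, mul_one, mul_zero]
      have e3 : ∑ p ∈ J', (q⁻¹) ^ p.1.card = ∑ e ∈ F S, (q⁻¹) ^ e.card *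
          ∑ c, if e ∈ F (B c) ∧ ∀ j ≠ j₀, e ∈ F (A j) then 1 else 0 := by
        rw [Finset.sum_filter, Finset.sum_product]
        refine Finset.sum_congr rfl fun e _ => ?_
        rw [Finset.mul_sum]
        exact Finset.sum_congr rfl fun j _ => by rw [mul_ite, mul_one, mul_zero]
      rw [e1, e2, e3, Finset.mul_sum, Finset.mul_sum, ← Finset.sum_add_distrib,
        ← Finset.sum_add_distrib]
      refine Finset.sum_le_sum fun e _ => ?_
      have hpos : 0 < (q⁻¹) ^ e.card := by positivity
      have hcardι : 1 ≤ Fintype.card ι := Fintype.card_pos_iff.2 ⟨j₀⟩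
      have hcR : (∑ c, if e ∈ F (B c) then (1 : ℝ) else 0) ≤ r := by
        calc _ ≤ ∑ c : R, (1 : ℝ) := Finset.sum_le_sum fun c _ => by split_ifs <;> norm_num
          _ = r := by simp [hr]
      have hc0 : 0 ≤ (∑ c, if e ∈ F (B c) then (1 : ℝ) else 0) :=
        Finset.sum_nonneg fun c _ => by split_ifs <;> norm_num
      have hcR' : r⁻¹ * (∑ c, if e ∈ F (B c) then (1 : ℝ) else 0) ≤ 1 := by
        rw [inv_mul_le_iff₀ hr0]; linarith
      suffices h : (∑ j ∈ Finset.univ.erase j₀, if e ∈ F (A j) then (1 : ℝ) else 0) +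
          r⁻¹ * (∑ c, if e ∈ F (B c) then (1 : ℝ) else 0) ≤
          q + ∑ c, if e ∈ F (B c) ∧ ∀ j ≠ j₀, e ∈ F (A j) then (1 : ℝ) else 0 by
        have := mul_le_mul_of_nonneg_left h hpos.le
        linarith
      by_cases hall : ∀ j ≠ j₀, e ∈ F (A j)
      · have h1 : (∑ j ∈ Finset.univ.erase j₀, if e ∈ F (A j) then (1 : ℝ) else 0) ≤ q := by
          calc _ ≤ ∑ j ∈ Finset.univ.erase j₀, (1 : ℝ) :=
                Finset.sum_le_sum fun c _ => by split_ifs <;> norm_num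
            _ = Fintype.card ι - 1 := by
                rw [Finset.sum_const, Finset.card_erase_of_mem (Finset.mem_univ _),
                  Finset.card_univ, nsmul_eq_mul, mul_one, Nat.cast_sub hcardι, Nat.cast_one]
            _ ≤ q := hq'
        have h2 : (∑ c, if e ∈ F (B c) ∧ ∀ j ≠ j₀, e ∈ F (A j) then (1 : ℝ) else 0) =
            ∑ c, if e ∈ F (B c) then (1 : ℝ) else 0 :=
          Finset.sum_congr rfl fun c _ => if_congr (and_iff_left hall) rfl rfl
        rw [h2]
        have h3 : r⁻¹ ≤ 1 := inv_le_one_of_one_le₀ (by rw [hr]; exact_mod_cast hR)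
        have := mul_le_mul_of_nonneg_right h3 hc0
        linarith
      · have hall' := hall
        push Not at hall'
        obtain ⟨j, hj, hje⟩ := hall'
        have h1 : (∑ j ∈ Finset.univ.erase j₀, if e ∈ F (A j) then (1 : ℝ) else 0) + 1 ≤
            Fintype.card ι - 1 := by
          have hjm : j ∈ Finset.univ.erase j₀ := Finset.mem_erase.2 ⟨hj, Finset.mem_univ _⟩
          calc _ ≤ ∑ i ∈ Finset.univ.erase j₀,
                ((if e ∈ F (A i) then (1 : ℝ) else 0) + if i = j then 1 else 0) := by
                rw [Finset.sum_add_distrib, Finset.sum_ite_eq' _ j, if_pos hjm]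
            _ ≤ ∑ i ∈ Finset.univ.erase j₀, (1 : ℝ) := by
                refine Finset.sum_le_sum fun i _ => ?_
                by_cases hij : i = j
                · subst hij; rw [if_neg hje]; simp
                · rw [if_neg hij]; split_ifs <;> norm_num
            _ = Fintype.card ι - 1 := by
                rw [Finset.sum_const, Finset.card_erase_of_mem (Finset.mem_univ _),
                  Finset.card_univ, nsmul_eq_mul, mul_one, Nat.cast_sub hcardι, Nat.cast_one]
        have h2 : 0 ≤ ∑ c, if e ∈ F (B c) ∧ ∀ j ≠ j₀, e ∈ F (A j) then (1 : ℝ) else 0 :=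
          Finset.sum_nonneg fun c _ => by split_ifs <;> norm_num
        linarith
    calc _ ≤ ∑ j ∈ Finset.univ.erase j₀, q ^ Z.card * W (A j) +
          r⁻¹ * ∑ c, q ^ Z.card * W (B c) := by
          gcongr with j _ c _
          · exact hA j
          · exact hB c
      _ = q ^ Z.card * (∑ j ∈ Finset.univ.erase j₀, W (A j) + r⁻¹ * ∑ c, W (B c)) := by
          rw [← Finset.mul_sum, ← Finset.mul_sum]; ring
      _ ≤ q ^ Z.card * (q * ∑ e ∈ G, (q⁻¹) ^ e.card) := by
          gcongr; exact hW.trans hGW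
      _ = _ := by rw [Finset.card_insert_of_notMem ht, pow_succ, mul_assoc]

/-- The tuple `A` of sets has independence sets of positive upper density along the forward
iterates of `T`. -/
def PosDensIndep {X ι : Type*} (T : X → X) (A : ι → Set X) : Prop :=
  ∃ δ : ℝ, 0 < δ ∧ ∀ N₀ : ℕ, ∃ N ≥ N₀, ∃ J ⊆ Finset.range N, δ * N ≤ J.card ∧
    ∀ σ : ℕ → ι, ∃ x, ∀ t ∈ J, T^[t] x ∈ A (σ t)

theorem PosDensIndep.nonempty {X ι : Type*} {T : X → X} {A : ι → Set X} (h : PosDensIndep T A)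
    (j : ι) : (A j).Nonempty := by
  obtain ⟨δ, hδ, h⟩ := h
  obtain ⟨N, hN, J, -, hJ, hA⟩ := h 1
  have : (0 : ℝ) < J.card := by
    have : (1 : ℝ) ≤ N := by exact_mod_cast hN
    have := mul_pos hδ (by linarith : (0 : ℝ) < N)
    linarith
  obtain ⟨t, ht⟩ := Finset.card_pos.1 (by exact_mod_cast this : 0 < J.card)
  obtain ⟨x, hx⟩ := hA fun _ => j
  exact ⟨_, hx t ht⟩

theorem PosDensIndep.of_forall_finset {X ι ι' R : Type*} [Finite R] {T : X → X} {A : ι → Set X}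
    {A' : R → ι' → Set X} (h : PosDensIndep T A) {γ : ℝ} (hγ : 0 < γ)
    (hstep : ∀ J : Finset ℕ, (∀ σ : ℕ → ι, ∃ x, ∀ t ∈ J, T^[t] x ∈ A (σ t)) →
      ∃ c, ∃ J' ⊆ J, γ * J.card ≤ J'.card ∧ ∀ σ : ℕ → ι', ∃ x, ∀ t ∈ J', T^[t] x ∈ A' c (σ t)) :
    ∃ c, PosDensIndep T (A' c) := by
  obtain ⟨δ, hδ, h⟩ := h
  by_contra! hcon
  have : ∀ c, ∃ N₀, ∀ N ≥ N₀, ∀ J ⊆ Finset.range N, γ * δ * N ≤ J.card →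
      ¬ ∀ σ : ℕ → ι', ∃ x, ∀ t ∈ J, T^[t] x ∈ A' c (σ t) := by
    intro c
    by_contra! h'
    exact hcon c ⟨γ * δ, mul_pos hγ hδ, h'⟩
  choose N₀ hN₀ using this
  obtain ⟨M, hM⟩ := (Set.finite_range N₀).bddAbove
  obtain ⟨N, hN, J, hJN, hJ, hA⟩ := h M
  obtain ⟨c, J', hJ', hcard, hA'⟩ := hstep J hA
  refine hN₀ c N ((hM ⟨c, rfl⟩).trans hN) J' (hJ'.trans hJN) ?_ hA'
  calc γ * δ * N = γ * (δ * N) := by ring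
    _ ≤ γ * J.card := by gcongr
    _ ≤ _ := hcard

open Classical in
theorem PosDensIndep.exists_update_inter {X ι R : Type*} [Finite ι] [Finite R]
    {T : X → X} {A : ι → Set X} (h : PosDensIndep T A) (j₀ : ι) {B : R → Set X}
    (hB : A j₀ ⊆ ⋃ c, B c) :
    ∃ c, PosDensIndep T (Function.update A j₀ (A j₀ ∩ B c)) := by
  cases nonempty_fintype ι
  cases nonempty_fintype R
  obtain ⟨x₀, hx₀⟩ := h.nonempty j₀
  obtain ⟨c₀, -⟩ := Set.mem_iUnion.1 (hB hx₀)
  set p : ℝ := (Fintype.card ι : ℝ) with hp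
  set r : ℝ := (Fintype.card R : ℝ) with hr
  have hR : 0 < Fintype.card R := Fintype.card_pos_iff.2 ⟨c₀⟩
  have hr0 : 0 < r := by rw [hr]; exact_mod_cast hR
  have hp1 : 1 ≤ p := by
    rw [hp]; exact_mod_cast (Fintype.card_pos_iff.2 ⟨j₀⟩ : 0 < Fintype.card ι)
  set q : ℝ := p - 1 + r⁻¹ / 2 with hq
  have hri : 0 < r⁻¹ := inv_pos.2 hr0
  have hq0 : 0 < q := by linarith
  set ρ₀ : ℝ := (p - 1 + r⁻¹) / q with hρ₀
  have hρ₀1 : 1 < ρ₀ := by rw [hρ₀, one_lt_div hq0]; linarith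
  set ρ : ℝ := ρ₀ ^ (r⁻¹) with hρ
  have hρ1 : 1 < ρ := Real.one_lt_rpow hρ₀1 hri
  have hρr : ρ ^ Fintype.card R = ρ₀ := by
    rw [← Real.rpow_natCast, hρ, ← Real.rpow_mul (by linarith), inv_mul_cancel₀ hr0.ne',
      Real.rpow_one]
  obtain ⟨γ, hγ, hbig⟩ := exists_mem_card_ge_of_weight (inv_pos.2 hq0) hρ1
  refine h.of_forall_finset hγ fun J hA => ?_
  choose x hx using fun σ : J → ι => hA fun t => if ht : t ∈ J then σ ⟨t, ht⟩ else j₀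
  have hx' : ∀ σ : J → ι, ∀ t : J, T^[t] (x σ) ∈ A (σ t) := by
    intro σ t
    have := hx σ t t.2
    simpa using this
  let g (σ : J → ι) (t : J) : R :=
    if ht : T^[t] (x σ) ∈ A j₀ then (Set.mem_iUnion.1 (hB ht)).choose else c₀
  have hg : ∀ σ (t : J), T^[t] (x σ) ∈ A j₀ → T^[t] (x σ) ∈ B (g σ t) := by
    intro σ t ht
    simp only [g, dif_pos ht]
    exact (Set.mem_iUnion.1 (hB ht)).choose_spec
  have hsum := sum_colored_weight_le hR j₀ g hq0 (by rw [← hp]; linarith)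
    (Finset.univ : Finset J) Finset.univ (fun σ _ τ _ h => funext fun t => h t (Finset.mem_univ _))
  have hlhs : ∑ σ : J → ι, ((Fintype.card R : ℝ)⁻¹) ^
      ((Finset.univ : Finset J).filter fun t => σ t = j₀).card = (p - 1 + r⁻¹) ^ J.card := by
    have h1 : ∀ σ : J → ι, ((Fintype.card R : ℝ)⁻¹) ^
      ((Finset.univ : Finset J).filter fun t => σ t = j₀).card =
        ∏ t, if σ t = j₀ then r⁻¹ else 1 := by
      intro σ
      rw [Finset.prod_ite, Finset.prod_const, Finset.prod_const_one, mul_one]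
    have h2 : ∑ j : ι, (if j = j₀ then r⁻¹ else 1) = p - 1 + r⁻¹ := by
      rw [← Finset.sum_erase_add _ _ (Finset.mem_univ j₀), if_pos rfl,
        Finset.sum_congr rfl fun j hj => if_neg (Finset.mem_erase.1 hj).1, Finset.sum_const,
        Finset.card_erase_of_mem (Finset.mem_univ _), Finset.card_univ, nsmul_eq_mul, mul_one,
        Nat.cast_sub (Fintype.card_pos_iff.2 ⟨j₀⟩), Nat.cast_one]
    have h3 := Finset.prod_univ_sum (fun _ : J => (Finset.univ : Finset ι))
      (fun _ j => if j = j₀ then r⁻¹ else 1)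
    rw [Finset.sum_congr rfl fun σ _ => h1 σ, ← h2]
    rw [Fintype.piFinset_univ] at h3
    rw [← h3, Finset.prod_const, Finset.card_univ, Fintype.card_coe]
  rw [hlhs] at hsum
  have hcardJ : (Finset.univ : Finset J).card = J.card := by simp
  obtain ⟨e, heF, he⟩ := hbig _ ((Finset.univ : Finset J) ×ˢ (Finset.univ : Finset R))
    (((Finset.univ : Finset J) ×ˢ (Finset.univ : Finset R)).powerset.filter
        (RealizesColored j₀ g Finset.univ))
    (fun e he => Finset.mem_powerset.1 (Finset.mem_filter.1 he).1) (by
      rw [Finset.card_product, mul_comm, pow_mul, Finset.card_univ (α := R), hρr, hcardJ, hρ₀,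
        div_pow, div_le_iff₀' (by positivity)]
      rw [hcardJ] at hsum
      exact hsum)
  have heR := (Finset.mem_filter.1 heF).2
  rw [Finset.card_product, hcardJ, Finset.card_univ] at he
  obtain ⟨c, hc⟩ : ∃ c, γ * J.card ≤ (e.filter fun p => p.2 = c).card := by
    by_contra! hcon
    have h1 : e.card = ∑ c, (e.filter fun p => p.2 = c).card :=
      Finset.card_eq_sum_card_fiberwise (fun _ _ => Finset.mem_univ _)
    have h2 : (∑ c, ((e.filter fun p => p.2 = c).card : ℝ)) < ∑ c : R, γ * J.card :=
      Finset.sum_lt_sum_of_nonempty ⟨c₀, Finset.mem_univ _⟩ fun c _ => hcon c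
    rw [Finset.sum_const, Finset.card_univ, nsmul_eq_mul] at h2
    rw [h1] at he
    push_cast at he
    linarith
  refine ⟨c, (e.filter fun p => p.2 = c).image (fun p => (p.1 : ℕ)), ?_, ?_, fun σ => ?_⟩
  · intro t ht
    obtain ⟨p, -, rfl⟩ := Finset.mem_image.1 ht
    exact p.1.2
  · rw [Finset.card_image_of_injOn]
    · exact hc
    · intro p hp p' hp' h
      have h1 := (Finset.mem_filter.1 hp).2
      have h2 := (Finset.mem_filter.1 hp').2
      exact Prod.ext (Subtype.ext h) (h1.trans h2.symm)
  · obtain ⟨s, -, hs⟩ := heR fun t => σ t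
    refine ⟨x s, fun t ht => ?_⟩
    obtain ⟨p, hp, rfl⟩ := Finset.mem_image.1 ht
    rw [Finset.mem_filter] at hp
    obtain ⟨h1, h2⟩ := hs p hp.1
    have h3 := hx' s p.1
    rw [h1] at h3
    by_cases hj : σ p.1 = j₀
    · rw [hj, Function.update_self]
      rw [hj] at h3
      refine ⟨h3, ?_⟩
      have := hg s p.1 h3
      rwa [h2 hj, hp.2] at this
    · rwa [Function.update_of_ne hj]

open Classical in
theorem PosDensIndep.exists_inter {X ι R : Type*} [Finite ι] [Finite R]
    {T : X → X} {A : ι → Set X} (h : PosDensIndep T A) [Nonempty R] {B : R → Set X}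
    (hB : ⋃ c, B c = univ) :
    ∃ c : ι → R, PosDensIndep T (fun j => A j ∩ B (c j)) := by
  cases nonempty_fintype ι
  suffices H : ∀ s : Finset ι, ∃ c : ι → R,
      PosDensIndep T (fun j => if j ∈ s then A j ∩ B (c j) else A j) by
    simpa using H Finset.univ
  intro s
  induction s using Finset.induction_on with
  | empty => exact ⟨fun _ => Classical.arbitrary R, by simpa using h⟩
  | insert j s hj ih =>
    obtain ⟨c, hc⟩ := ih
    obtain ⟨d, hd⟩ := hc.exists_update_inter j (B := B) (by rw [hB]; exact subset_univ _)
    refine ⟨Function.update c j d, ?_⟩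
    convert hd using 1
    funext i
    by_cases hij : i = j
    · subst hij; simp [hj]
    · simp [hij]

theorem exists_pow_le_card_of_coverEntropy_pos {X : Type*} [PseudoMetricSpace X] {T : X → X}
    (h : 0 < Dynamics.coverEntropy T Set.univ) :
    ∃ ε > 0, ∃ ρ : ℝ, 1 < ρ ∧ ∀ N₀ : ℕ, ∃ n ≥ N₀, ∀ s : Finset X,
      (∀ x, ∃ y ∈ s, ∀ t < n, dist (T^[t] x) (T^[t] y) < ε) → ρ ^ n ≤ s.card := by
  rw [Dynamics.coverEntropy] at h
  obtain ⟨U, hU⟩ := lt_iSup_iff.1 h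
  obtain ⟨hU', hU⟩ := lt_iSup_iff.1 hU
  obtain ⟨ε, hε, hεU⟩ := Metric.mem_uniformity_dist.1 hU'
  obtain ⟨c, hc0, hc⟩ := EReal.lt_iff_exists_real_btwn.1 hU
  have hc0' : 0 < c := by exact_mod_cast hc0
  have hfreq := Filter.frequently_lt_of_lt_limsup (by isBoundedDefault) hc
  refine ⟨ε, hε, Real.exp c, Real.one_lt_exp_iff.2 hc0', fun N₀ => ?_⟩
  obtain ⟨n, hn, hlt⟩ := Filter.frequently_atTop.1 hfreq (N₀ + 1)
  refine ⟨n, by omega, fun s hs => ?_⟩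
  have hcov : Dynamics.IsDynCoverOf T Set.univ U n (s : Set X) := by
    intro x _
    obtain ⟨y, hy, hxy⟩ := hs x
    exact ⟨y, hy, Dynamics.mem_dynEntourage.2 fun t ht => hεU (hxy t ht)⟩
  have h1 := hcov.coverMincard_le_card
  have hn0 : 0 < n := by omega
  have h2 : (c : EReal) * n < ENNReal.log (s.card : ENNReal) := by
    have h3 : ENNReal.log ((Dynamics.coverMincard T Set.univ U n : ℕ∞) : ENNReal) ≤
        ENNReal.log (s.card : ENNReal) :=
      ENNReal.log_monotone (by
        have := ENat.toENNReal_mono h1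
        simpa using this)
    have h4 : (c : EReal) < ENNReal.log (s.card : ENNReal) / n :=
      hlt.trans_le (EReal.div_le_div_right_of_nonneg (by positivity) h3)
    exact (EReal.lt_div_iff (by exact_mod_cast hn0) (EReal.natCast_ne_top n)).1 h4
  have hs0 : s.card ≠ 0 := by
    intro h0
    rw [h0] at h2
    simp at h2
  have hs1 : (0 : ℝ) < s.card := by exact_mod_cast Nat.pos_of_ne_zero hs0
  have h5 : ENNReal.log (s.card : ENNReal) = (Real.log s.card : ℝ) := by
    rw [ENNReal.log_pos_real (by exact_mod_cast hs0) (ENNReal.natCast_ne_top _)]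
    simp
  rw [h5] at h2
  have h6 : c * n < Real.log s.card := by exact_mod_cast h2
  rw [← Real.exp_nat_mul, mul_comm, ← Real.le_log_iff_exp_le hs1]
  exact h6.le

open Classical in
theorem exists_separated_finset {X R : Type*} [PseudoMetricSpace X] [Fintype R] {T : X → X}
    {ε : ℝ} (hε : 0 < ε) {z : R → X} (hz : ∀ x, ∃ i, dist x (z i) < ε / 8)
    {η ρ : ℝ} (hη : 0 < η) (hρ : 0 ≤ ρ) {n : ℕ} (hn : 0 < n)
    (hcov : ∀ s : Finset X,
      (∀ x, ∃ y ∈ s, ∀ t < n, dist (T^[t] x) (T^[t] y) < ε) → ρ ^ 2 ≤ s.card)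
    (hfew : ∀ F : Finset (Finset (ℕ × R)), (∀ e ∈ F, e ⊆ Finset.range n ×ˢ Finset.univ) →
      (∀ e ∈ F, (e.card : ℝ) < η * n) → (F.card : ℝ) < ρ) :
    ∃ M : Finset X, ρ ≤ M.card ∧ ∀ x ∈ M, ∀ y ∈ M, x ≠ y → η * n ≤
      ((Finset.range n).filter fun t => ε / 2 ≤ dist (T^[t] x) (T^[t] y)).card := by
  by_contra! hcon
  let far (x y : X) := (Finset.range n).filter fun t => ε / 2 ≤ dist (T^[t] x) (T^[t] y)
  have hfar_symm : ∀ x y, far x y = far y x := fun x y => by simp only [far, dist_comm]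
  let Sep (M : Finset X) : Prop := ∀ x ∈ M, ∀ y ∈ M, x ≠ y → η * n ≤ (far x y).card
  have hSep : ∀ M, Sep M → (M.card : ℝ) < ρ := by
    intro M hM
    by_contra! h
    obtain ⟨x, hx, y, hy, hxy, h'⟩ := hcon M h
    exact absurd (hM x hx y hy hxy) (not_le.2 h')
  obtain ⟨M, hM, hmax⟩ : ∃ M, Sep M ∧ ∀ M', Sep M' → M'.card ≤ M.card := by
    let p (k : ℕ) : Prop := ∃ M, Sep M ∧ M.card = k
    have hp0 : p 0 := ⟨∅, by simp [Sep], rfl⟩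
    obtain ⟨M, hM, hMc⟩ := Nat.findGreatest_spec (P := p) (Nat.zero_le ⌈ρ⌉₊) hp0
    refine ⟨M, hM, fun M' hM' => ?_⟩
    rw [hMc]
    refine Nat.le_findGreatest ?_ ⟨M', hM', rfl⟩
    exact_mod_cast (hSep M' hM').le.trans (Nat.le_ceil ρ)
  have hn0 : (0 : ℝ) < n := by exact_mod_cast hn
  have hclose : ∀ x, ∃ y ∈ M, ((far x y).card : ℝ) < η * n := by
    intro x
    by_cases hx : x ∈ M
    · refine ⟨x, hx, ?_⟩
      have : far x x = ∅ := by
        simp only [far, dist_self]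
        exact Finset.filter_false_of_mem fun _ _ => not_le.2 (by linarith)
      rw [this]; simpa using mul_pos hη hn0
    · by_contra! hfar
      have : Sep (insert x M) := by
        intro u hu v hv huv
        rcases Finset.mem_insert.1 hu with hu' | hu' <;>
          rcases Finset.mem_insert.1 hv with hv' | hv'
        · exact absurd (hu'.trans hv'.symm) huv
        · rw [hu']; exact hfar v hv'
        · rw [hv', hfar_symm]; exact hfar u hu'
        · exact hM u hu' v hv' huv
      have := hmax _ this
      rw [Finset.card_insert_of_notMem hx] at this
      omega
  choose y hyM hy using hclose
  choose κ hκ using hz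
  let e (x : X) : Finset (ℕ × R) := (far x (y x)).image fun t => (t, κ (T^[t] x))
  let F := ((Finset.range n) ×ˢ (Finset.univ : Finset R)).powerset.filter
    fun e => (e.card : ℝ) < η * n
  have heF : ∀ x, e x ∈ F := by
    intro x
    simp only [F, Finset.mem_filter, Finset.mem_powerset]
    refine ⟨fun p hp => ?_, lt_of_le_of_lt ?_ (hy x)⟩
    · obtain ⟨t, ht, rfl⟩ := Finset.mem_image.1 hp
      simpa using (Finset.mem_filter.1 ht).1
    · exact_mod_cast Finset.card_image_le
  have hF := hfew F (fun e he => Finset.mem_powerset.1 (Finset.mem_filter.1 he).1)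
    (fun e he => (Finset.mem_filter.1 he).2)
  have hM' := hSep M hM
  let G (x : X) := (y x, e x)
  rcases isEmpty_or_nonempty X with hX | hX
  · have h1 := hcov ∅ (fun x => (hX.false x).elim)
    simp only [Finset.card_empty, Nat.cast_zero] at h1
    have : ρ = 0 := by nlinarith
    rw [this] at hF
    exact absurd hF (not_lt.2 (Nat.cast_nonneg _))
  have hinv : ∀ x, G (Function.invFun G (G x)) = G x := fun x => Function.invFun_eq ⟨x, rfl⟩
  have h1 := hcov ((M ×ˢ F).image (Function.invFun G)) fun x => by
    refine ⟨Function.invFun G (G x), Finset.mem_image_of_mem _ (Finset.mem_product.2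
      ⟨hyM x, heF x⟩), fun t ht => ?_⟩
    have h2 := hinv x
    set w := Function.invFun G (G x)
    obtain ⟨hyw, hew⟩ : y w = y x ∧ e w = e x := Prod.mk.inj h2
    by_cases htx : t ∈ far x (y x)
    · have h3 : (t, κ (T^[t] x)) ∈ e w := by
        rw [hew]; exact Finset.mem_image_of_mem _ htx
      obtain ⟨t', -, ht'⟩ := Finset.mem_image.1 h3
      obtain ⟨rfl, hk⟩ := Prod.mk.inj ht'
      have a1 := hκ (T^[t'] x)
      have a2 := hκ (T^[t'] w)
      rw [hk, dist_comm] at a2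
      have := dist_triangle (T^[t'] x) (z (κ (T^[t'] x))) (T^[t'] w)
      linarith
    · have htw : t ∉ far w (y w) := by
        intro h
        have h3 : (t, κ (T^[t] w)) ∈ e x := by
          rw [← hew]; exact Finset.mem_image_of_mem _ h
        obtain ⟨t', ht'', ht'⟩ := Finset.mem_image.1 h3
        obtain ⟨rfl, hk⟩ := Prod.mk.inj ht'
        exact htx ht''
      have a : ∀ u, t ∉ far u (y u) → dist (T^[t] u) (T^[t] (y u)) < ε / 2 := by
        intro u hu
        by_contra! h
        exact hu (Finset.mem_filter.2 ⟨Finset.mem_range.2 ht, h⟩)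
      have a1 := a x htx
      have a2 := a w htw
      rw [hyw, dist_comm] at a2
      have := dist_triangle (T^[t] x) (T^[t] (y x)) (T^[t] w)
      linarith
  have hu0 : (0 : ℝ) ≤ M.card := Nat.cast_nonneg _
  have hv0 : (0 : ℝ) ≤ F.card := Nat.cast_nonneg _
  have h2 : (((M ×ˢ F).image (Function.invFun G)).card : ℝ) ≤ M.card * F.card := by
    have h2' := Finset.card_image_le (s := M ×ˢ F) (f := Function.invFun G)
    rw [Finset.card_product] at h2'
    rw [← Nat.cast_mul]
    exact Nat.cast_le.2 h2'
  generalize (M.card : ℝ) = u, (F.card : ℝ) = v at *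
  have h3 : u * v < ρ * ρ := mul_lt_mul'' hM' hF hu0 hv0
  rw [sq] at h1
  exact absurd (h1.trans h2) (not_le.2 h3)

open Classical in
theorem exists_posDensIndep_pair {X : Type*} [PseudoMetricSpace X] [CompactSpace X] {T : X → X}
    (h : 0 < Dynamics.coverEntropy T Set.univ) :
    ∃ A : Bool → Set X, (∀ b, IsClosed (A b)) ∧ Disjoint (A false) (A true) ∧
      PosDensIndep T A := by
  obtain ⟨ε, hε, ρ, hρ, hcov⟩ := exists_pow_le_card_of_coverEntropy_pos h
  obtain ⟨Z, -, hZf, hZ⟩ := Metric.totallyBounded_iff.1 (isCompact_univ (X := X)).totallyBounded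
    (ε / 8) (by positivity) |>.imp fun Z hZ => (⟨trivial, hZ.1, hZ.2⟩ : True ∧ _ ∧ _)
  have : Fintype Z := hZf.fintype
  have hz : ∀ x, ∃ i : Z, dist x (i : X) < ε / 8 := by
    intro x
    obtain ⟨i, hi, hx⟩ := Set.mem_iUnion₂.1 (hZ (mem_univ x))
    exact ⟨⟨i, hi⟩, hx⟩
  have hXne : Nonempty X := by
    by_contra hX
    rw [not_nonempty_iff] at hX
    obtain ⟨n, -, hn⟩ := hcov 0
    have h1 := hn ∅ fun x => (hX.false x).elim
    have : 0 < ρ ^ n := by positivity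
    simp at h1; linarith
  obtain ⟨z₀, -⟩ := hz (Classical.arbitrary X)
  set r : ℝ := (Fintype.card Z : ℝ) with hr
  have hr' : 0 < Fintype.card Z := Fintype.card_pos_iff.2 ⟨z₀⟩
  have hr0 : 0 < r := by rw [hr]; exact_mod_cast hr'
  set ρ' : ℝ := Real.sqrt ρ with hρ'
  have hρ'2 : ρ' ^ 2 = ρ := Real.sq_sqrt (by linarith)
  have hρ'1 : 1 < ρ' := by rw [hρ', Real.lt_sqrt (by norm_num)]; linarith
  have hroot : ∀ k : ℕ, 0 < k → ∃ s : ℝ, 1 < s ∧ s ^ k = ρ' := by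
    intro k hk
    have hk' : (0 : ℝ) < k := by exact_mod_cast hk
    refine ⟨ρ' ^ ((k : ℝ)⁻¹), Real.one_lt_rpow hρ'1 (inv_pos.2 hk'), ?_⟩
    rw [← Real.rpow_natCast, ← Real.rpow_mul (by linarith), inv_mul_cancel₀ hk'.ne', Real.rpow_one]
  obtain ⟨s₁, hs₁, hs₁'⟩ := hroot _ hr'
  obtain ⟨γ, hγ, hbig⟩ := exists_mem_card_ge_of_weight one_pos hs₁
  obtain ⟨K, hK⟩ : ∃ K : ℕ, 4 ≤ γ * 4 ^ (K + 1) := by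
    obtain ⟨K, hK⟩ := pow_unbounded_of_one_lt (1 / γ) (by norm_num : (1 : ℝ) < 4)
    refine ⟨K, ?_⟩
    rw [div_lt_iff₀ hγ] at hK
    rw [pow_succ]; linarith
  obtain ⟨s₂, hs₂, hs₂'⟩ := hroot (Fintype.card Z * (K + 1)) (by positivity)
  obtain ⟨γ₂, hγ₂, hbig₂⟩ := exists_mem_card_ge_of_weight one_pos hs₂
  let A (i : Z) (b : Bool) : Set X :=
    if b then {x | dist x i ≤ ε / 8} else {x | ε / 4 ≤ dist x i}
  have hAdisj : ∀ i, Disjoint (A i true) (A i false) := by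
    intro i
    rw [Set.disjoint_left]
    intro x h1 h2
    simp only [A, if_true, Bool.false_eq_true, if_false, Set.mem_ofPred_eq] at h1 h2
    linarith
  suffices H : ∃ i, PosDensIndep T (A i) by
    obtain ⟨i, hi⟩ := H
    refine ⟨A i, fun b => ?_, (hAdisj i).symm, hi⟩
    cases b
    · simp only [A, Bool.false_eq_true, if_false]
      exact isClosed_le continuous_const (by fun_prop)
    · simp only [A, if_true]
      exact isClosed_le (by fun_prop) continuous_const
  by_contra! hcon
  have hcon' : ∀ i, ∃ N₀, ∀ N ≥ N₀, ∀ J ⊆ Finset.range N, γ₂ * N ≤ J.card →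
      ¬ ∀ σ : ℕ → Bool, ∃ x, ∀ t ∈ J, T^[t] x ∈ A i (σ t) := by
    intro c
    by_contra! h'
    exact hcon c ⟨γ₂, hγ₂, h'⟩
  choose N₀ hN₀ using hcon'
  obtain ⟨M₀, hM₀⟩ := (Set.finite_range N₀).bddAbove
  obtain ⟨n, hn, hcn⟩ := hcov (M₀ + 1)
  have hn0 : 0 < n := by omega
  have hDcard : ((Finset.range n) ×ˢ (Finset.univ : Finset Z)).card = n * Fintype.card Z := by
    rw [Finset.card_product, Finset.card_range, Finset.card_univ]
  obtain ⟨M, hMcard, hM⟩ := exists_separated_finset (T := T) (n := n) (η := γ * r) (ρ := ρ' ^ n)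
    hε hz (by positivity) (by positivity) hn0
    (fun s hs => by
      rw [← pow_mul, mul_comm, pow_mul, hρ'2]; exact hcn s hs)
    (fun F hF hF' => by
      by_contra! hle
      obtain ⟨e, he, hge⟩ := hbig _ _ F hF (by
        rw [hDcard, mul_comm, pow_mul, hs₁']; simpa using hle)
      have := hF' e he
      rw [hDcard] at hge
      push_cast at hge
      have e1 : γ * (n * (Fintype.card Z : ℝ)) = γ * r * n := by rw [hr]; ring
      linarith)
  let P (c : ℕ × Z) : Set X := {x | T^[c.1] x ∈ A c.2 true}
  let Q (c : ℕ × Z) : Set X := {x | T^[c.1] x ∈ A c.2 false}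
  have hPQ : ∀ c, Disjoint (P c) (Q c) := by
    intro c
    rw [Set.disjoint_left]
    exact fun x h1 h2 => Set.disjoint_left.1 (hAdisj c.2) h1 h2
  choose κ hκ using hz
  have hcard := card_le_card_realizesAll_pow hPQ (D := (Finset.range n) ×ˢ (Finset.univ : Finset Z))
    ⟨(0, z₀), by simpa using hn0⟩ hK M (fun x hx y hy hxy => by
      have h1 := hM x hx y hy hxy
      have e1 : γ * (((Finset.range n) ×ˢ (Finset.univ : Finset Z)).card : ℝ) = γ * r * n := by
        rw [hDcard, hr]; push_cast; ring
      rw [e1]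
      refine h1.trans ?_
      rw [Nat.cast_le, ← Finset.card_image_of_injective
        ((Finset.range n).filter fun t => ε / 2 ≤ dist (T^[t] x) (T^[t] y))
        (f := fun t => (t, κ (T^[t] x))) (fun t t' h => (Prod.mk.inj h).1)]
      refine Finset.card_le_card fun c hc => ?_
      obtain ⟨t, ht, rfl⟩ := Finset.mem_image.1 hc
      rw [Finset.mem_filter] at ht
      refine Finset.mem_filter.2 ⟨by simpa using ht.1, Or.inl ⟨?_, ?_⟩⟩
      · simp only [P, A, if_true, Set.mem_ofPred_eq]; exact (hκ _).le
      · simp only [Q, A, Bool.false_eq_true, if_false, Set.mem_ofPred_eq]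
        have a1 := hκ (T^[t] x)
        have a2 := dist_triangle (T^[t] x) (κ (T^[t] x) : X) (T^[t] y)
        rw [dist_comm (κ (T^[t] x) : X) (T^[t] y)] at a2
        linarith [ht.2])
  set Sh := (((Finset.range n) ×ˢ (Finset.univ : Finset Z)).powerset.filter (RealizesAll P Q M))
  have hSh : s₂ ^ ((Finset.range n) ×ˢ (Finset.univ : Finset Z)).card ≤ Sh.card := by
    rw [← pow_le_pow_iff_left₀ (n := K + 1) (by positivity) (Nat.cast_nonneg _) (by omega),
      hDcard, ← pow_mul, show n * Fintype.card Z * (K + 1) = (Fintype.card Z * (K + 1)) * n by ring,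
      pow_mul, hs₂']
    exact hMcard.trans (by exact_mod_cast hcard)
  have hSum : ∑ e ∈ Sh, (1 : ℝ) ^ e.card = Sh.card := by
    rw [Finset.sum_congr rfl fun e _ => one_pow e.card, Finset.sum_const, nsmul_eq_mul, mul_one]
  obtain ⟨e, he, hge⟩ := hbig₂ _ _ Sh
    (fun e he => Finset.mem_powerset.1 (Finset.mem_filter.1 he).1) (hSh.trans hSum.ge)
  obtain ⟨i, hi⟩ : ∃ i, γ₂ * n ≤ (e.filter fun p => p.2 = i).card := by
    by_contra! hcon
    have h1 : e.card = ∑ c, (e.filter fun p => p.2 = c).card :=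
      Finset.card_eq_sum_card_fiberwise (fun _ _ => Finset.mem_univ _)
    have h2 : (∑ c, ((e.filter fun p => p.2 = c).card : ℝ)) < ∑ c : Z, γ₂ * n :=
      Finset.sum_lt_sum_of_nonempty ⟨z₀, Finset.mem_univ _⟩ fun c _ => hcon c
    rw [Finset.sum_const, Finset.card_univ, nsmul_eq_mul] at h2
    rw [h1, hDcard] at hge
    push_cast at hge
    linarith
  refine hN₀ i n (by have := hM₀ ⟨i, rfl⟩; omega)
    ((e.filter fun p => p.2 = i).image Prod.fst) ?_ ?_ fun σ => ?_
  · intro t ht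
    obtain ⟨p, hp, rfl⟩ := Finset.mem_image.1 ht
    have := Finset.mem_powerset.1 (Finset.mem_filter.1 he).1 (Finset.mem_filter.1 hp).1
    exact (Finset.mem_product.1 this).1
  · rw [Finset.card_image_of_injOn]
    · exact hi
    · intro p hp p' hp' h
      exact Prod.ext h ((Finset.mem_filter.1 hp).2.trans (Finset.mem_filter.1 hp').2.symm)
  · obtain ⟨x, -, hx⟩ := (Finset.mem_filter.1 he).2 fun c => σ c.1
    refine ⟨x, fun t ht => ?_⟩
    obtain ⟨⟨t, i'⟩, hp, rfl⟩ := Finset.mem_image.1 ht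
    rw [Finset.mem_filter] at hp
    obtain ⟨hp, rfl⟩ := hp
    have := hx _ hp
    cases hσ : σ t <;> simpa [hσ, P, Q] using this

/-- The empirical averages of `f` along orbit segments whose lengths tend to infinity converge,
along an ultrafilter, to the integrals with respect to an invariant probability measure. -/
theorem exists_measurePreserving_tendsto_birkhoffAverage {Y : Type*} [TopologicalSpace Y]
    [CompactSpace Y] [TopologicalSpace.MetrizableSpace Y] [MeasurableSpace Y] [BorelSpace Y]
    {S : Y → Y} (hS : Continuous S) (x : ℕ → Y)
    {N : ℕ → ℕ} (hN : Tendsto N atTop atTop) (hN0 : ∀ k, 0 < N k) :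
    ∃ ν : Measure Y, IsProbabilityMeasure ν ∧ MeasurePreserving S ν ν ∧
      ∀ f : BoundedContinuousFunction Y ℝ,
        Tendsto (fun k => (N k : ℝ)⁻¹ * ∑ t ∈ Finset.range (N k), f (S^[t] (x k)))
          (hyperfilter ℕ) (𝓝 (∫ y, f y ∂ν)) := by
  let m (k : ℕ) : Measure Y :=
    (N k : ENNReal)⁻¹ • ∑ t ∈ Finset.range (N k), Measure.dirac (S^[t] (x k))
  have hm : ∀ k, IsProbabilityMeasure (m k) := by
    intro k
    refine ⟨?_⟩
    simp only [m, Measure.smul_apply, Measure.coe_finsetSum, Finset.sum_apply, measure_univ,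
      Finset.sum_const, Finset.card_range, nsmul_eq_mul, mul_one, smul_eq_mul]
    exact ENNReal.inv_mul_cancel (by exact_mod_cast (hN0 k).ne') (ENNReal.natCast_ne_top _)
  have hint : ∀ (f : BoundedContinuousFunction Y ℝ) k,
      ∫ y, f y ∂(m k) = (N k : ℝ)⁻¹ * ∑ t ∈ Finset.range (N k), f (S^[t] (x k)) := by
    intro f k
    simp only [m]
    rw [integral_smul_measure, integral_finsetSum_measure fun i _ => f.integrable _]
    simp only [integral_dirac, ENNReal.toReal_inv, ENNReal.toReal_natCast, smul_eq_mul]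
  let P (k : ℕ) : ProbabilityMeasure Y := ⟨m k, hm k⟩
  let ν := (Ultrafilter.map P (hyperfilter ℕ)).lim
  have hν : Tendsto P (hyperfilter ℕ) (𝓝 ν) :=
    Ultrafilter.le_nhds_lim (Ultrafilter.map P (hyperfilter ℕ))
  have hlim : ∀ f : BoundedContinuousFunction Y ℝ,
      Tendsto (fun k => (N k : ℝ)⁻¹ * ∑ t ∈ Finset.range (N k), f (S^[t] (x k)))
        (hyperfilter ℕ) (𝓝 (∫ y, f y ∂(ν : Measure Y))) := by
    intro f
    have := ProbabilityMeasure.tendsto_iff_forall_integral_tendsto.1 hν f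
    exact this.congr fun k => hint f k
  refine ⟨ν, inferInstance, ⟨hS.measurable, ?_⟩, hlim⟩
  have : IsProbabilityMeasure (Measure.map S (ν : Measure Y)) :=
    Measure.isProbabilityMeasure_map hS.measurable.aemeasurable
  refine ext_of_forall_integral_eq_of_IsFiniteMeasure fun f => ?_
  rw [integral_map hS.measurable.aemeasurable f.continuous.aestronglyMeasurable]
  have h1 := (hlim (f.compContinuous ⟨S, hS⟩)).sub (hlim f)
  have h2 : Tendsto (fun k => (N k : ℝ)⁻¹ * (2 * ‖f‖)) (hyperfilter ℕ) (𝓝 0) := by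
    have h3 : Tendsto (fun k => (N k : ℝ)⁻¹) atTop (𝓝 0) :=
      tendsto_inv_atTop_zero.comp (tendsto_natCast_atTop_atTop.comp hN)
    simpa using (h3.mono_left Nat.hyperfilter_le_atTop).mul_const (2 * ‖f‖)
  refine sub_eq_zero.1 (tendsto_nhds_unique h1 (squeeze_zero_norm (fun k => ?_) h2))
  have h4 : ∑ t ∈ Finset.range (N k), (f.compContinuous ⟨S, hS⟩) (S^[t] (x k)) =
      ∑ t ∈ Finset.range (N k), f (S^[t + 1] (x k)) :=
    Finset.sum_congr rfl fun t _ => by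
      rw [Function.iterate_succ_apply']; rfl
  rw [h4, ← mul_sub, ← Finset.sum_sub_distrib, Finset.sum_range_sub
    (fun t => f (S^[t] (x k))), norm_mul, norm_inv, Real.norm_natCast]
  gcongr
  refine (norm_sub_le _ _).trans ?_
  have a1 := f.norm_coe_le_norm (S^[N k] (x k))
  have a2 := f.norm_coe_le_norm (S^[0] (x k))
  linarith

theorem exists_frequently_return {ℓ : ℕ} {a : Fin ℓ → ℕ → ℕ} (hgood : GoodLiminfRecurrence a)
    {δ : ℝ} (hδ : 0 < δ) {N : ℕ → ℕ} (hN : Tendsto N atTop atTop) (hN0 : ∀ k, 0 < N k)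
    {J : ℕ → Finset ℕ} (hJN : ∀ k, J k ⊆ Finset.range (N k))
    (hJ : ∀ k, δ * N k ≤ (J k).card) (n₀ : ℕ) :
    ∃ n ≥ n₀, ∃ δ' : ℝ, 0 < δ' ∧ ∃ᶠ k in atTop,
      δ' * N k ≤ ((J k).filter fun t => ∀ i, t + a i n ∈ J k).card := by
  let S : (ℤ → Bool) ≃ₜ (ℤ → Bool) :=
    { toFun := fun x m => x (m + 1)
      invFun := fun x m => x (m - 1)
      left_inv := fun x => by funext m; simp
      right_inv := fun x => by funext m; simp
      continuous_toFun := continuous_pi fun m => continuous_apply _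
      continuous_invFun := continuous_pi fun m => continuous_apply _ }
  have hSiter : ∀ (t : ℕ) (x : ℤ → Bool) (m : ℤ), (⇑S)^[t] x m = x (m + t) := by
    intro t
    induction t with
    | zero => intro x m; simp
    | succ t ih =>
      intro x m
      rw [Function.iterate_succ_apply, ih]
      change x (m + t + 1) = _
      push_cast; rw [add_assoc]
  let x (k : ℕ) (m : ℤ) : Bool := decide (0 ≤ m ∧ m.toNat ∈ J k)
  have hx : ∀ k (t : ℕ), x k t = true ↔ t ∈ J k := fun k t => by simp [x]
  obtain ⟨ν, hν, hSν, hlim⟩ :=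
    exists_measurePreserving_tendsto_birkhoffAverage S.continuous x hN hN0
  let C : Set (ℤ → Bool) := {y | y 0 = true}
  have hCclopen : IsClopen C := (isClopen_discrete {true}).preimage (continuous_apply (0 : ℤ))
  let D (n : ℕ) : Set (ℤ → Bool) := C ∩ ⋂ i : Fin ℓ, (⇑S)^[a i n] ⁻¹' C
  have hDclopen : ∀ n, IsClopen (D n) := fun n =>
    hCclopen.inter (isClopen_iInter_of_finite fun i =>
      hCclopen.preimage (S.continuous.iterate _))
  have hcount : ∀ (B : Set (ℤ → Bool)) (hB : IsClopen B) k (p : ℕ → Prop) [DecidablePred p],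
      (∀ t, S^[t] (x k) ∈ B ↔ t ∈ J k ∧ p t) →
      ∑ t ∈ Finset.range (N k), BoundedContinuousFunction.indicator B hB ((⇑S)^[t] (x k)) =
        ((J k).filter p).card := by
    intro B hB k p _ h
    have h1 : ∀ t ∈ Finset.range (N k),
        BoundedContinuousFunction.indicator B hB ((⇑S)^[t] (x k)) =
          if t ∈ J k ∧ p t then (1 : ℝ) else 0 := by
      intro t _
      by_cases ht : t ∈ J k ∧ p t
      · rw [if_pos ht]
        exact Set.indicator_of_mem ((h t).2 ht) _
      · rw [if_neg ht]
        exact Set.indicator_of_notMem (fun h' => ht ((h t).1 h')) _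
    rw [Finset.sum_congr rfl h1, Finset.sum_boole]
    congr 2
    ext t
    simp only [Finset.mem_filter]
    exact ⟨fun h => h.2, fun h => ⟨hJN k h.1, h⟩⟩
  have hC : ∀ k t, (⇑S)^[t] (x k) ∈ C ↔ t ∈ J k := by
    intro k t
    change (⇑S)^[t] (x k) 0 = true ↔ _
    rw [hSiter, zero_add, hx]
  have hD : ∀ n k t, (⇑S)^[t] (x k) ∈ D n ↔ t ∈ J k ∧ ∀ i, t + a i n ∈ J k := by
    intro n k t
    simp only [D, Set.mem_inter_iff, Set.mem_iInter, Set.mem_preimage,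
      ← Function.iterate_add_apply, hC, add_comm]
  have hind : ∀ (B : Set (ℤ → Bool)) (hB : IsClopen B),
      ∫ y, BoundedContinuousFunction.indicator B hB y ∂ν = (ν B).toReal := fun B hB =>
    integral_indicator_one hB.isOpen.measurableSet
  have hνC : 0 < ν C := by
    have h1 := hlim (BoundedContinuousFunction.indicator C hCclopen)
    rw [hind] at h1
    have h2 : δ ≤ (ν C).toReal := by
      refine ge_of_tendsto h1 (Eventually.of_forall fun k => ?_)
      rw [hcount C hCclopen k (fun _ => True) (by simpa using hC k)]
      have : (0 : ℝ) < N k := by exact_mod_cast hN0 k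
      rw [inv_mul_eq_div, le_div_iff₀ this]
      simpa using hJ k
    exact (ENNReal.toReal_pos_iff.1 (hδ.trans_le h2)).1
  have hrec := hgood (ℤ → Bool) ν S.toMeasurableEquiv hSν C hCclopen.isOpen.measurableSet hνC
  change 0 < Filter.atTop.liminf (fun N : ℕ => (1 / N : ℝ) * ∑ n ∈ Finset.Icc 1 N,
    (ν (D n)).toReal) at hrec
  obtain ⟨n, hn, hνn⟩ : ∃ n ≥ n₀, 0 < (ν (D n)).toReal := by
    by_contra! hcon
    have h0 : ∀ n ≥ n₀, (ν (D n)).toReal = 0 := fun n hn =>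
      le_antisymm (hcon n hn) ENNReal.toReal_nonneg
    have h1 : Tendsto (fun N : ℕ => (1 / N : ℝ) * ∑ n ∈ Finset.Icc 1 N, (ν (D n)).toReal)
        atTop (𝓝 0) := by
      have h2 : Tendsto (fun N : ℕ => (1 / N : ℝ) *
          ∑ n ∈ Finset.Icc 1 n₀, (ν (D n)).toReal) atTop (𝓝 0) := by
        simpa using tendsto_one_div_atTop_nhds_zero_nat.mul_const
          (∑ n ∈ Finset.Icc 1 n₀, (ν (D n)).toReal)
      refine h2.congr' ?_
      filter_upwards [eventually_ge_atTop n₀] with M hM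
      congr 1
      refine Finset.sum_subset (Finset.Icc_subset_Icc_right hM) fun n hn hn' => h0 n ?_
      simp only [Finset.mem_Icc] at hn hn'
      omega
    rw [h1.liminf_eq] at hrec
    exact lt_irrefl _ hrec
  refine ⟨n, hn, (ν (D n)).toReal / 2, by positivity, ?_⟩
  have h1 := hlim (BoundedContinuousFunction.indicator (D n) (hDclopen n))
  rw [hind] at h1
  have h2 := (h1.eventually (lt_mem_nhds (half_lt_self hνn))).frequently
  refine (h2.filter_mono Nat.hyperfilter_le_atTop).mono fun k hk => ?_
  rw [hcount _ _ k _ (hD n k)] at hk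
  have : (0 : ℝ) < N k := by exact_mod_cast hN0 k
  rw [inv_mul_eq_div, lt_div_iff₀ this] at hk
  exact hk.le

theorem CondStarStar.eventually_injective {ℓ : ℕ} {a : Fin ℓ → ℕ → ℕ} (h : CondStarStar a) :
    ∀ᶠ n in atTop, Function.Injective fun i => a i n := by
  cases ℓ with
  | zero => exact Eventually.of_forall fun n i => i.elim0
  | succ m =>
    have h1 : ∀ i : Fin m, ∀ᶠ n in atTop, a i.castSucc n < a i.succ n := by
      intro i
      filter_upwards [(h.2 i (by omega)).eventually_gt_atTop 0] with n hn
      have e1 : (⟨i + 1, by omega⟩ : Fin (m + 1)) = i.succ := rfl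
      have e2 : (⟨i, by omega⟩ : Fin (m + 1)) = i.castSucc := rfl
      rw [e1, e2] at hn
      omega
    filter_upwards [eventually_all.2 h1] with n hn
    exact (Fin.strictMono_iff_lt_succ.2 hn).injective

theorem PosDensIndep.exists_return {ℓ : ℕ} {a : Fin ℓ → ℕ → ℕ} (hpos : ∀ i n, 0 < a i n)
    (hΛ : CondStarStar a) (hgood : GoodLiminfRecurrence a) {X ι : Type*} {T : X → X}
    {A : ι → Set X} (h : PosDensIndep T A) (n₀ : ℕ) :
    ∃ n ≥ n₀, ∀ {κ : Type*} (φ₀ : κ → ι) (φ : κ → Fin ℓ → ι),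
      PosDensIndep T fun q => A (φ₀ q) ∩ ⋂ i, T^[a i n] ⁻¹' A (φ q i) := by
  obtain ⟨δ, hδ, h⟩ := h
  choose N hN J hJN hJ hA using fun k => h (k + 1)
  obtain ⟨n₁, hn₁⟩ := eventually_atTop.1 hΛ.eventually_injective
  obtain ⟨n, hn, δ', hδ', hfreq⟩ := exists_frequently_return hgood hδ
    (tendsto_atTop_mono (fun k => (Nat.le_succ k).trans (hN k)) tendsto_id)
    (fun k => Nat.succ_pos k |>.trans_le (hN k)) hJN hJ (max n₀ n₁)
  refine ⟨n, (le_max_left _ _).trans hn, fun {κ} φ₀ φ => ?_⟩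
  let g (o : Option (Fin ℓ)) : ℕ := o.elim 0 fun i => a i n
  have hg : Function.Injective g := by
    intro o o' ho
    rcases o with - | i <;> rcases o' with - | i'
    · rfl
    · exact absurd ho (hpos i' n).ne
    · exact absurd ho (hpos i n).ne'
    · exact congrArg some (hn₁ n ((le_max_right _ _).trans hn) ho)
  obtain ⟨m, hm⟩ : ∃ m, ∀ o, g o < m := by
    obtain ⟨m, hm⟩ := (Set.finite_range g).bddAbove
    exact ⟨m + 1, fun o => Nat.lt_succ_of_le (hm ⟨o, rfl⟩)⟩
  have hm0 : 0 < m := (Nat.zero_le _).trans_lt (hm none)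
  have hm0' : (0 : ℝ) < m := by exact_mod_cast hm0
  refine ⟨δ' / m, by positivity, fun N₀ => ?_⟩
  obtain ⟨k, hk, hret⟩ := frequently_atTop.1 hfreq N₀
  set J' := (J k).filter fun t => ∀ i, t + a i n ∈ J k with hJ'
  obtain ⟨r, hr⟩ : ∃ r, δ' / m * N k ≤ (J'.filter fun t => t % m = r).card := by
    by_contra! hcon
    have h1 : J'.card = ∑ r ∈ Finset.range m, (J'.filter fun t => t % m = r).card :=
      Finset.card_eq_sum_card_fiberwise fun t _ => by
        simpa using Nat.mod_lt t hm0
    have h2 : (∑ r ∈ Finset.range m, ((J'.filter fun t => t % m = r).card : ℝ)) <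
        ∑ r ∈ Finset.range m, δ' / m * N k :=
      Finset.sum_lt_sum_of_nonempty ⟨0, by simpa using hm0⟩ fun c _ => hcon c
    rw [Finset.sum_const, Finset.card_range, nsmul_eq_mul, ← mul_assoc,
      mul_div_cancel₀ _ hm0'.ne'] at h2
    rw [h1] at hret
    push_cast at hret
    linarith
  refine ⟨N k, hk.trans ((Nat.le_succ k).trans (hN k)), _, fun t ht => ?_, hr, fun σ => ?_⟩
  · exact hJN k (Finset.mem_filter.1 (Finset.mem_filter.1 ht).1).1
  · let f (p : ↥(J'.filter fun t => t % m = r) × Option (Fin ℓ)) : ℕ := p.1 + g p.2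
    have hf : Function.Injective f := by
      rintro ⟨⟨t, ht⟩, o⟩ ⟨⟨t', ht'⟩, o'⟩ hp
      have hp' : t + g o = t' + g o' := hp
      have ht1 := (Finset.mem_filter.1 ht).2
      have ht2 := (Finset.mem_filter.1 ht').2
      have h1 : g o = g o' := by
        have h2 : t + g o ≡ t + g o' [MOD m] := by
          conv_lhs => rw [hp']
          exact Nat.ModEq.add_right _ (ht2.trans ht1.symm)
        have h3 := Nat.ModEq.add_left_cancel' _ h2
        rwa [Nat.ModEq, Nat.mod_eq_of_lt (hm o), Nat.mod_eq_of_lt (hm o')] at h3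
      have h4 : t = t' := by omega
      subst h4
      rw [hg h1]
    obtain ⟨x, hx⟩ := hA k (Function.extend f
      (fun p => p.2.elim (φ₀ (σ p.1)) (φ (σ p.1))) fun _ => φ₀ (σ 0))
    refine ⟨x, fun t ht => ?_⟩
    have ht' := Finset.mem_filter.1 (Finset.mem_filter.1 ht).1
    refine ⟨?_, Set.mem_iInter.2 fun i => ?_⟩
    · have h1 := hx t ht'.1
      have h2 := hf.extend_apply (fun p => p.2.elim (φ₀ (σ p.1)) (φ (σ p.1)))
        (fun _ => φ₀ (σ 0)) (⟨t, ht⟩, none)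
      change Function.extend _ _ _ t = φ₀ (σ t) at h2
      rwa [h2] at h1
    · have h1 := hx _ (ht'.2 i)
      have h2 := hf.extend_apply (fun p => p.2.elim (φ₀ (σ p.1)) (φ (σ p.1)))
        (fun _ => φ₀ (σ 0)) (⟨t, ht⟩, some i)
      change Function.extend _ _ _ (t + a i n) = φ (σ t) i at h2
      rw [h2, add_comm, Function.iterate_add_apply] at h1
      exact h1

theorem PosDensIndep.exists_split {ℓ : ℕ} (hℓ : 1 ≤ ℓ) {a : Fin ℓ → ℕ → ℕ}
    (hpos : ∀ i n, 0 < a i n) (hΛ : CondStarStar a) (hgood : GoodLiminfRecurrence a)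
    {X ι κ : Type*} [TopologicalSpace X] {T : X → X} (hT : Continuous T) {A : ι → Set X}
    (hA : PosDensIndep T A) (hcl : ∀ j, IsClosed (A j))
    (hdisj : Pairwise (Function.onFun Disjoint A))
    {b : Bool → ι} (hb : Function.Injective b) {p : κ → ι} {l : κ → Bool}
    (hpl : ∀ q q', p q = p q' → l q = l q' → q = q') :
    ∃ A' : κ → Set X, PosDensIndep T A' ∧ (∀ q, IsClosed (A' q)) ∧
      Pairwise (Function.onFun Disjoint A') ∧
      ∀ q, A' q ⊆ A (p q) := by
  obtain ⟨n, -, hn⟩ := hA.exists_return hpos hΛ hgood 0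
  refine ⟨_, hn p fun q _ => b (l q), fun q => ?_, fun q q' hqq => ?_, fun q x hx => hx.1⟩
  · exact (hcl _).inter (isClosed_iInter fun i => (hcl _).preimage (hT.iterate _))
  · rw [Function.onFun, Set.disjoint_left]
    intro x hx hx'
    by_cases h1 : p q = p q'
    · have h2 : l q ≠ l q' := fun h2 => hqq (hpl q q' h1 h2)
      exact Set.disjoint_left.1 (hdisj (hb.ne h2)) (Set.mem_iInter.1 hx.2 ⟨0, hℓ⟩)
        (Set.mem_iInter.1 hx'.2 ⟨0, hℓ⟩)
    · exact Set.disjoint_left.1 (hdisj h1) hx.1 hx'.1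

theorem PosDensIndep.exists_shrink {X ι : Type*} [PseudoMetricSpace X] [CompactSpace X]
    [Finite ι] [Nonempty ι] {T : X → X} {A : ι → Set X} (hA : PosDensIndep T A)
    (hcl : ∀ j, IsClosed (A j)) {ε : ℝ} (hε : 0 < ε) :
    ∃ A' : ι → Set X, PosDensIndep T A' ∧ (∀ j, IsClosed (A' j)) ∧ (∀ j, A' j ⊆ A j) ∧
      ∀ j, ∀ x ∈ A' j, ∀ y ∈ A' j, dist x y ≤ ε := by
  obtain ⟨Z, hZf, hZ⟩ := Metric.totallyBounded_iff.1 (isCompact_univ (X := X)).totallyBounded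
    (ε / 2) (by positivity)
  have : Finite Z := hZf
  have hB : ⋃ z : Z, Metric.closedBall (z : X) (ε / 2) = univ := by
    refine eq_univ_of_forall fun x => ?_
    obtain ⟨z, hz, hx⟩ := Set.mem_iUnion₂.1 (hZ (mem_univ x))
    exact Set.mem_iUnion.2 ⟨⟨z, hz⟩, Metric.ball_subset_closedBall hx⟩
  have : Nonempty Z := by
    obtain ⟨x, -⟩ := hA.nonempty (Classical.arbitrary ι)
    obtain ⟨z, -⟩ := Set.mem_iUnion.1 (hB.ge (mem_univ x))
    exact ⟨z⟩
  obtain ⟨c, hc⟩ := hA.exists_inter hB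
  refine ⟨_, hc, fun j => (hcl j).inter Metric.isClosed_closedBall, fun j x hx => hx.1,
    fun j x hx y hy => ?_⟩
  have := dist_triangle_right x y (c j : X)
  have h1 := Metric.mem_closedBall.1 hx.2
  have h2 := Metric.mem_closedBall.1 hy.2
  linarith

theorem PosDensIndep.exists_refine {ℓ : ℕ} {a : Fin ℓ → ℕ → ℕ}
    (hpos : ∀ i n, 0 < a i n) (hΛ : CondStarStar a) (hgood : GoodLiminfRecurrence a)
    {X : Type*} {ι : Type} [TopologicalSpace X] {T : X → X} (hT : Continuous T) {A : ι → Set X}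
    (hA : PosDensIndep T A) (hcl : ∀ j, IsClosed (A j)) (Φ : Set (ι → Fin ℓ → ι))
    (hΦ : Φ.Finite) :
    ∃ A' : ι → Set X, PosDensIndep T A' ∧ (∀ j, IsClosed (A' j)) ∧ (∀ j, A' j ⊆ A j) ∧
      ∀ s ∈ Φ, ∃ n ≥ 1, ∀ j i, ∀ x ∈ A' j, T^[a i n] x ∈ A (s j i) := by
  induction Φ, hΦ using Set.Finite.induction_on with
  | empty => exact ⟨A, hA, hcl, fun j => subset_rfl, fun s hs => hs.elim⟩
  | @insert s Φ _ _ ih =>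
    obtain ⟨A', hA', hcl', hsub, h⟩ := ih
    obtain ⟨n, hn, hret⟩ := hA'.exists_return hpos hΛ hgood 1
    refine ⟨_, hret id s, fun j => ?_, fun j x hx => hsub j hx.1, fun s' hs' => ?_⟩
    · exact (hcl' _).inter (isClosed_iInter fun i => (hcl' _).preimage (hT.iterate _))
    · rcases hs' with rfl | hs'
      · exact ⟨n, hn, fun j i x hx => hsub _ (Set.mem_iInter.1 hx.2 i)⟩
      · obtain ⟨n', hn', h'⟩ := h s' hs'
        exact ⟨n', hn', fun j i x hx => h' j i x hx.1⟩

theorem PosDensIndep.exists_step {ℓ : ℕ} (hℓ : 1 ≤ ℓ) {a : Fin ℓ → ℕ → ℕ}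
    (hpos : ∀ i n, 0 < a i n) (hΛ : CondStarStar a) (hgood : GoodLiminfRecurrence a)
    {X : Type*} [PseudoMetricSpace X] [CompactSpace X] {T : X → X} (hT : Continuous T)
    {ι κ : Type} [Finite κ] [Nonempty κ] {A : ι → Set X}
    (hA : PosDensIndep T A) (hcl : ∀ j, IsClosed (A j))
    (hdisj : Pairwise (Function.onFun Disjoint A))
    {b : Bool → ι} (hb : Function.Injective b) {p : κ → ι} {l : κ → Bool}
    (hpl : ∀ q q', p q = p q' → l q = l q' → q = q') {ε : ℝ} (hε : 0 < ε) :
    ∃ A' : κ → Set X, (PosDensIndep T A' ∧ (∀ q, IsClosed (A' q)) ∧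
      Pairwise (Function.onFun Disjoint A')) ∧
      (∀ q, A' q ⊆ A (p q)) ∧ (∀ q, ∀ x ∈ A' q, ∀ y ∈ A' q, dist x y ≤ ε) ∧
      ∀ s : κ → Fin ℓ → κ, ∃ n ≥ 1, ∀ q i, ∀ x ∈ A' q, ∀ y ∈ A' (s q i),
        dist (T^[a i n] x) y ≤ ε := by
  obtain ⟨A₁, hA₁, hcl₁, hdisj₁, hsub₁⟩ :=
    hA.exists_split hℓ hpos hΛ hgood hT hcl hdisj hb hpl
  obtain ⟨A₂, hA₂, hcl₂, hsub₂, hdist₂⟩ := hA₁.exists_shrink hcl₁ hε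
  obtain ⟨A₃, hA₃, hcl₃, hsub₃, hret₃⟩ :=
    hA₂.exists_refine hpos hΛ hgood hT hcl₂ Set.univ Set.finite_univ
  refine ⟨A₃, ⟨hA₃, hcl₃, fun q q' h => (hdisj₁ h).mono ((hsub₃ _).trans (hsub₂ _))
      ((hsub₃ _).trans (hsub₂ _))⟩,
    fun q => (hsub₃ q).trans ((hsub₂ q).trans (hsub₁ q)),
    fun q x hx y hy => hdist₂ q x (hsub₃ q hx) y (hsub₃ q hy), fun s => ?_⟩
  obtain ⟨n, hn, h⟩ := hret₃ s (mem_univ s)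
  exact ⟨n, hn, fun q i x hx y hy => hdist₂ _ _ (h q i x hx) y (hsub₃ _ hy)⟩

theorem exists_return_scheme {ℓ : ℕ} (hℓ : 1 ≤ ℓ) {a : Fin ℓ → ℕ → ℕ}
    (hpos : ∀ i n, 0 < a i n) (hΛ : CondStarStar a) (hgood : GoodLiminfRecurrence a)
    {X : Type*} [PseudoMetricSpace X] [CompactSpace X] {T : X → X} (hT : Continuous T)
    (hent : 0 < Dynamics.coverEntropy T Set.univ) :
    ∃ A : ∀ k : ℕ, (Fin (k + 1) → Bool) → Set X,
      (∀ k q, IsClosed (A k q)) ∧ (∀ k q, (A k q).Nonempty) ∧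
      (∀ k, Pairwise (Function.onFun Disjoint (A k))) ∧ (∀ k q, A (k + 1) q ⊆ A k (Fin.init q)) ∧
      (∀ k q, ∀ x ∈ A (k + 1) q, ∀ y ∈ A (k + 1) q, dist x y ≤ 1 / (k + 1)) ∧
      ∀ (k : ℕ) (s : (Fin (k + 2) → Bool) → Fin ℓ → Fin (k + 2) → Bool), ∃ n ≥ 1, ∀ q i,
        ∀ x ∈ A (k + 1) q, ∀ y ∈ A (k + 1) (s q i), dist (T^[a i n] x) y ≤ 1 / (k + 1) := by
  obtain ⟨B, hBcl, hBdisj, hB⟩ := exists_posDensIndep_pair hent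
  let Good (k : ℕ) := {A : (Fin (k + 1) → Bool) → Set X // PosDensIndep T A ∧
    (∀ q, IsClosed (A q)) ∧ Pairwise (Function.onFun Disjoint A)}
  have hBij : Function.Injective fun q : Fin 1 → Bool => q 0 := fun q q' h =>
    funext fun i => by rw [Subsingleton.elim i 0]; exact h
  let A₀ : Good 0 := ⟨fun q => B (q 0), by
    obtain ⟨δ, hδ, h⟩ := hB
    refine ⟨δ, hδ, fun N₀ => ?_⟩
    obtain ⟨N, hN, J, hJN, hJ, h⟩ := h N₀
    exact ⟨N, hN, J, hJN, hJ, fun σ => h fun t => σ t 0⟩, fun q => hBcl _, fun q q' h => by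
    have h' := hBij.ne h
    rw [Function.onFun]
    change q 0 ≠ q' 0 at h'
    cases h1 : q 0 <;> cases h2 : q' 0
    · exact absurd (h1.trans h2.symm) h'
    · exact hBdisj
    · exact hBdisj.symm
    · exact absurd (h1.trans h2.symm) h'⟩
  have hstep : ∀ (k : ℕ) (A : Good k), ∃ A' : Good (k + 1),
      (∀ q, A'.1 q ⊆ A.1 (Fin.init q)) ∧
      (∀ q, ∀ x ∈ A'.1 q, ∀ y ∈ A'.1 q, dist x y ≤ 1 / ((k : ℝ) + 1)) ∧
      ∀ s : (Fin (k + 2) → Bool) → Fin ℓ → Fin (k + 2) → Bool, ∃ n ≥ 1, ∀ q i,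
        ∀ x ∈ A'.1 q, ∀ y ∈ A'.1 (s q i), dist (T^[a i n] x) y ≤ 1 / ((k : ℝ) + 1) := by
    intro k A
    obtain ⟨A', h1, h2⟩ := A.2.1.exists_step hℓ hpos hΛ hgood hT A.2.2.1 A.2.2.2
      (b := fun β _ => β) (fun β β' h => congrFun h 0)
      (p := fun q : Fin (k + 2) → Bool => Fin.init q) (l := fun q => q (Fin.last _))
      (fun q q' h h' => by
        rw [← Fin.snoc_init_self q, ← Fin.snoc_init_self q', h, h'])
      (ε := 1 / ((k : ℝ) + 1)) (by positivity)
    exact ⟨⟨A', h1⟩, h2⟩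
  choose next hnext using hstep
  let A (k : ℕ) : Good k := Nat.rec A₀ next k
  exact ⟨fun k => (A k).1, fun k => (A k).2.2.1, fun k q => (A k).2.1.nonempty q,
    fun k => (A k).2.2.2, fun k => (hnext k (A k)).1, fun k => (hnext k (A k)).2.1,
    fun k => (hnext k (A k)).2.2⟩

/-- The first `k + 1` terms of a sequence. -/
def initialWord (k : ℕ) (z : ℕ → Bool) : Fin (k + 1) → Bool := fun i => z i

/-- The extension of a finite word by zeros. -/
def extendWord {k : ℕ} (q : Fin (k + 1) → Bool) : ℕ → Bool :=
  fun i => if h : i < k + 1 then q ⟨i, h⟩ else false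

theorem initialWord_extendWord {k : ℕ} (q : Fin (k + 1) → Bool) :
    initialWord k (extendWord q) = q := by
  funext i
  exact dif_pos i.2

theorem exists_continuous_injective_of_scheme {X : Type*} [MetricSpace X] [CompactSpace X]
    {A : ∀ k : ℕ, (Fin (k + 1) → Bool) → Set X} (hcl : ∀ k q, IsClosed (A k q))
    (hne : ∀ k q, (A k q).Nonempty) (hdisj : ∀ k, Pairwise (Function.onFun Disjoint (A k)))
    (hsub : ∀ k q, A (k + 1) q ⊆ A k (Fin.init q))
    (hdiam : ∀ k q, ∀ x ∈ A (k + 1) q, ∀ y ∈ A (k + 1) q, dist x y ≤ 1 / (k + 1)) :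
    ∃ h : (ℕ → Bool) → X, Continuous h ∧ Function.Injective h ∧
      ∀ z k, h z ∈ A k (initialWord k z) := by
  have hex : ∀ z : ℕ → Bool, (⋂ k, A k (initialWord k z)).Nonempty := fun z =>
    IsCompact.nonempty_iInter_of_sequence_nonempty_isCompact_isClosed _
      (fun k => hsub k (initialWord (k + 1) z)) (fun k => hne k _) (hcl 0 _).isCompact
      fun k => hcl k _
  choose h hh using hex
  have hmem : ∀ z k, h z ∈ A k (initialWord k z) := fun z k => Set.mem_iInter.1 (hh z) k
  refine ⟨h, continuous_iff_continuousAt.2 fun z => ?_, fun z w hzw => ?_, hmem⟩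
  · refine Metric.tendsto_nhds.2 fun ε hε => ?_
    obtain ⟨k, hk⟩ := exists_nat_one_div_lt hε
    have hcont : Continuous (initialWord (k + 1)) :=
      continuous_pi fun i => continuous_apply _
    have hopen := (isOpen_discrete {initialWord (k + 1) z}).preimage hcont
    filter_upwards [hopen.mem_nhds rfl] with w hw
    have hw' : initialWord (k + 1) w = initialWord (k + 1) z := hw
    exact (hdiam k _ _ (hw' ▸ hmem w (k + 1)) _ (hmem z (k + 1))).trans_lt hk
  · by_contra hne
    obtain ⟨k, hk⟩ := Function.ne_iff.1 hne
    have h1 : initialWord k z ≠ initialWord k w := fun h => hk (congrFun h (Fin.last k))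
    exact Set.disjoint_left.1 (hdisj k h1) (hmem z k) (hzw ▸ hmem w k)

theorem isCantorSet_range {X : Type*} [TopologicalSpace X] [T2Space X] {h : (ℕ → Bool) → X}
    (hc : Continuous h) (hi : Function.Injective h) : IsCantorSet (range h) := by
  have he := hc.isClosedEmbedding hi
  refine ⟨range_nonempty h, isCompact_range hc, ⟨he.isClosed_range, ?_⟩,
    he.isEmbedding.isTotallyDisconnected_range.2 inferInstance⟩
  rintro _ ⟨z, rfl⟩
  rw [accPt_iff_frequently]
  let w (k : ℕ) : ℕ → Bool := Function.update z k (!z k)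
  have hw : Tendsto w atTop (𝓝 z) := by
    refine tendsto_pi_nhds.2 fun i => tendsto_const_nhds.congr' ?_
    filter_upwards [eventually_gt_atTop i] with k hk
    exact (Function.update_of_ne hk.ne _ _).symm
  refine ((hc.tendsto z).comp hw).frequently
    (Eventually.of_forall fun k => ⟨?_, w k, rfl⟩).frequently
  intro hk
  have := congrFun (hi hk) k
  simp [w] at this

theorem iterate_comp_left {X ι : Type*} (T : X → X) (n : ℕ) (y : ι → X) :
    (fun y : ι → X => T ∘ y)^[n] y = T^[n] ∘ y := by
  induction n generalizing y with
  | zero => rfl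
  | succ n ih => rw [Function.iterate_succ_apply, ih, Function.iterate_succ, Function.comp_assoc]

theorem deltaWeakMixAlong_range_of_scheme {ℓ : ℕ} {a : Fin ℓ → ℕ → ℕ} {X : Type*}
    [MetricSpace X] {T : X → X} (hT : Continuous T)
    {A : ∀ k : ℕ, (Fin (k + 1) → Bool) → Set X}
    (hdiam : ∀ k q, ∀ x ∈ A (k + 1) q, ∀ y ∈ A (k + 1) q, dist x y ≤ 1 / (k + 1))
    (hret : ∀ (k : ℕ) (s : (Fin (k + 2) → Bool) → Fin ℓ → Fin (k + 2) → Bool), ∃ n ≥ 1,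
      ∀ q i, ∀ x ∈ A (k + 1) q, ∀ y ∈ A (k + 1) (s q i),
        dist (T^[a i n] x) y ≤ 1 / (k + 1))
    {h : (ℕ → Bool) → X} (hc : Continuous h) (hmem : ∀ z k, h z ∈ A k (initialWord k z)) :
    DeltaWeakMixAlong T a (range h) := by
  intro m _
  let F : Set (Fin m → X) := {y | ∀ j, y j ∈ range h}
  let G (k : ℕ) (s : Fin m → Fin ℓ → Fin (k + 2) → Bool) : Set F :=
    {y | ∃ n ≥ 1, ∀ j i, dist (T^[a i n] (y.1 j)) (h (extendWord (s j i))) < 1 / ((k : ℝ) + 1)}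
  have hopen : ∀ k s, IsOpen (G k s) := by
    intro k s
    have : G k s = ⋃ n : ℕ, ⋃ _ : n ≥ 1, ⋂ j, ⋂ i,
        {y : F | dist (T^[a i n] (y.1 j)) (h (extendWord (s j i))) < 1 / ((k : ℝ) + 1)} := by
      ext y
      simp [G]
    rw [this]
    refine isOpen_iUnion fun n => isOpen_iUnion fun _ => isOpen_iInter_of_finite fun j =>
      isOpen_iInter_of_finite fun i => isOpen_lt ?_ continuous_const
    exact ((hT.iterate _).comp ((continuous_apply j).comp continuous_subtype_val)).dist
      continuous_const
  have hdense : ∀ k s, Dense (G k s) := by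
    intro k s y
    choose z hz using y.2
    let w (L : ℕ) (j : Fin m) (p : ℕ) : Bool := if p ≤ L then z j p else decide (p = L + 1 + j)
    let u (L : ℕ) : F := ⟨fun j => h (w L j), fun j => ⟨_, rfl⟩⟩
    have hu : Tendsto u atTop (𝓝 y) := by
      refine tendsto_subtype_rng.2 (tendsto_pi_nhds.2 fun j => ?_)
      rw [← hz j]
      refine (hc.tendsto (z j)).comp (tendsto_pi_nhds.2 fun p => tendsto_const_nhds.congr' ?_)
      filter_upwards [eventually_ge_atTop p] with L hL
      exact (if_pos hL).symm
    refine mem_closure_of_tendsto hu ?_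
    filter_upwards [eventually_gt_atTop k] with L hL
    let r (j : Fin m) : Fin (L + m + 2) → Bool := initialWord (L + m + 1) (w L j)
    have hr : Function.Injective r := by
      intro j j' hj
      have h1 := congrFun hj ⟨L + 1 + j, by omega⟩
      simp only [r, initialWord, w] at h1
      rw [if_neg (by omega), if_neg (by omega)] at h1
      have h2 : L + 1 + (j : ℕ) = L + 1 + j' := by simpa using h1
      exact Fin.ext (by omega)
    obtain ⟨n, hn, hn'⟩ := hret (L + m) (Function.extend r
      (fun j i => initialWord (L + m + 1) (extendWord (s j i))) fun q _ => q)
    refine ⟨n, hn, fun j i => ?_⟩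
    have h1 := hn' (r j) i (h (w L j)) (hmem _ _) (h (extendWord (s j i))) (by
      rw [hr.extend_apply]; exact hmem _ _)
    refine h1.trans_lt (one_div_lt_one_div_of_lt (by positivity) ?_)
    have : (k : ℝ) < L := by exact_mod_cast hL
    push_cast
    have : (0 : ℝ) ≤ m := Nat.cast_nonneg _
    linarith
  refine ⟨⋂ k, ⋂ s, G k s, countable_iInter_mem.2 fun k => countable_iInter_mem.2 fun s =>
    residual_of_dense_open (hopen k s) (hdense k s), fun x hx v hv => ?_⟩
  refine Metric.mem_closure_iff.2 fun ε hε => ?_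
  choose z hz using hv
  obtain ⟨k, hk⟩ := exists_nat_one_div_lt (half_pos hε)
  obtain ⟨n, hn, hn'⟩ := Set.mem_iInter.1 (Set.mem_iInter.1 hx k)
    fun j i => initialWord (k + 1) (z i j)
  refine ⟨_, ⟨n, hn, rfl⟩, (dist_pi_lt_iff hε).2 fun i => (dist_pi_lt_iff hε).2 fun j => ?_⟩
  rw [iterate_comp_left, ← hz i j]
  have h1 := hn' j i
  have h2 := hdiam k _ _ (hmem (z i j) (k + 1)) (h (extendWord (initialWord (k + 1) (z i j)))) (by
    simpa only [initialWord_extendWord] using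
      hmem (extendWord (initialWord (k + 1) (z i j))) (k + 1))
  have h3 := dist_triangle_right (h (z i j)) (T^[a i n] (x.1 j))
    (h (extendWord (initialWord (k + 1) (z i j))))
  change dist (h (z i j)) (T^[a i n] (x.1 j)) < ε
  linarith

/-- Theorem: if `Λ = {a₁,…,a_ℓ}` satisfies Condition (**) and is good for
liminf-ℓ-recurrence, and the compact metric dynamical system `(X, T)` has positive
topological entropy, then `(X, T)` has a Δ-weakly mixing subset along `Λ`, which may be
taken to be a (closed) Cantor set. -/
theorem exists_deltaWeakMix_of_pos_entropy
    {ℓ : ℕ} (hℓ : 1 ≤ ℓ) (a : Fin ℓ → ℕ → ℕ) (hpos : ∀ i n, 0 < a i n)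
    (hΛ : CondStarStar a) (hgood : GoodLiminfRecurrence a)
    {X : Type*} [MetricSpace X] [CompactSpace X] (T : X ≃ₜ X)
    (hent : 0 < Dynamics.coverEntropy (⇑T) Set.univ) :
    ∃ E : Set X, IsClosed E ∧ IsCantorSet E ∧ DeltaWeakMixAlong (⇑T) a E := by
  obtain ⟨A, hcl, hne, hdisj, hsub, hdiam, hret⟩ :=
    exists_return_scheme hℓ hpos hΛ hgood T.continuous hent
  obtain ⟨h, hc, hi, hmem⟩ := exists_continuous_injective_of_scheme hcl hne hdisj hsub hdiam
  exact ⟨range h, (isCompact_range hc).isClosed, isCantorSet_range hc hi,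
    deltaWeakMixAlong_range_of_scheme T.continuous hdiam hret hc hmem⟩
end

section
/- Let Λ = {a_1,…,a_ℓ} be a collection of sequences of positive integers and (X,T) a topological dynamical system. A closed subset E of X is Δ-weakly mixing along Λ if and only if for every m ∈ ℕ and every choice of non-empty open subsets V_j and U_{i,j} of X (i ∈ {1,…,ℓ}, j ∈ {1,…,m}) each intersecting E, the intersection ⋂_{j=1}^{m} N_Λ(V_j ∩ E; U_{1,j},…,U_{ℓ,j}) is non-empty. -/
open MeasureTheory Filter Topology Set

/-- The hitting time set `N_Λ(V; U₁, …, U_ℓ) = {k ∈ ℕ : V ∩ T^{-a₁(k)}U₁ ∩ ⋯ ∩ T^{-a_ℓ(k)}U_ℓ ≠ ∅}`. -/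
def hittingTimes {X : Type*} {ℓ : ℕ} (T : X → X) (a : Fin ℓ → ℕ → ℕ)
    (V : Set X) (U : Fin ℓ → Set X) : Set ℕ :=
  {k | 1 ≤ k ∧ (V ∩ ⋂ i, T^[a i k] ⁻¹' (U i)).Nonempty}

theorem iterate_comp_left_apply {X ι : Type*} (T : X → X) (k : ℕ) (y : ι → X) :
    (fun y : ι → X => T ∘ y)^[k] y = T^[k] ∘ y := by
  induction k with
  | zero => rfl
  | succ k ih => rw [Function.iterate_succ_apply', ih, Function.iterate_succ', Function.comp_assoc]

/-- A set is Δ-transitive if open sets meeting it always have a common hitting time. -/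
theorem deltaTransAlong_of_hittingTimes_nonempty {Y : Type*} [TopologicalSpace Y]
    [SecondCountableTopology Y] {ℓ : ℕ} {S : Y → Y} (hS : Continuous S) (a : Fin ℓ → ℕ → ℕ)
    (F : Set Y)
    (h : ∀ (V : Set Y) (U : Fin ℓ → Set Y), IsOpen V → (V ∩ F).Nonempty →
      (∀ i, IsOpen (U i)) → (∀ i, (U i ∩ F).Nonempty) →
      (hittingTimes S a (V ∩ F) U).Nonempty) :
    DeltaTransAlong S a F := by
  let ret : (Fin ℓ → Set Y) → Set F := fun U =>
    {x | ∃ n : ℕ, 1 ≤ n ∧ ∀ i, S^[a i n] (x : Y) ∈ U i}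
  let B : Set (Fin ℓ → Set Y) :=
    {U | ∀ i, U i ∈ TopologicalSpace.countableBasis Y} ∩ {U | ∀ i, (U i ∩ F).Nonempty}
  have hB : B.Countable :=
    (Set.countable_pi fun _ => TopologicalSpace.countable_countableBasis Y).mono
      Set.inter_subset_left
  refine ⟨⋂ U ∈ B, ret U, (countable_bInter_mem hB).2 fun U hU => ?_, fun x hx y hy => ?_⟩
  · have hUo : ∀ i, IsOpen (U i) := fun i => TopologicalSpace.isOpen_of_mem_countableBasis (hU.1 i)
    refine residual_of_dense_open ?_ ?_
    · have : ret U = ⋃ n, ⋃ _ : 1 ≤ n, ⋂ i, (fun x : F => S^[a i n] (x : Y)) ⁻¹' U i := by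
        ext x; simp [ret]
      rw [this]
      exact isOpen_iUnion fun n => isOpen_iUnion fun _ => isOpen_iInter_of_finite fun i =>
        (hUo i).preimage ((hS.iterate _).comp continuous_subtype_val)
    · rw [dense_iff_inter_open]
      rintro W hW ⟨w, hw⟩
      obtain ⟨V, hV, rfl⟩ := isOpen_induced_iff.1 hW
      obtain ⟨n, hn, x, hx, hxU⟩ := h V U hV ⟨w, hw, w.2⟩ hUo hU.2
      exact ⟨⟨x, hx.2⟩, hx.1, n, hn, Set.mem_iInter.1 hxU⟩
  · rw [mem_closure_iff]
    intro O hO hyO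
    obtain ⟨u, hu, huO⟩ := isOpen_pi_iff'.1 hO y hyO
    choose b hb hyb hbu using fun i =>
      (TopologicalSpace.isBasis_countableBasis Y).exists_subset_of_mem_open (hu i).2 (hu i).1
    obtain ⟨n, hn, hxb⟩ := Set.mem_iInter₂.1 hx b ⟨hb, fun i => ⟨y i, hyb i, hy i⟩⟩
    exact ⟨_, huO fun i _ => hbu i (hxb i), n, hn, rfl⟩

/-- Proposition: a closed subset `E` of a compact metric dynamical system `(X, T)` is
Δ-weakly mixing along `Λ = {a₁,…,a_ℓ}` iff for every `m ∈ ℕ` and all non-empty open sets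
`V_j, U_{i,j}` (`1 ≤ i ≤ ℓ`, `1 ≤ j ≤ m`) intersecting `E`, one has
`⋂_{j=1}^m N_Λ(V_j ∩ E; U_{1,j}, …, U_{ℓ,j}) ≠ ∅`. -/
theorem deltaWeakMixAlong_iff_hittingTimes
    {ℓ : ℕ} (hℓ : 1 ≤ ℓ) (a : Fin ℓ → ℕ → ℕ) (hpos : ∀ i n, 0 < a i n)
    {X : Type*} [MetricSpace X] [CompactSpace X] (T : X ≃ₜ X)
    (E : Set X) (hE : IsClosed E) :
    DeltaWeakMixAlong (⇑T) a E ↔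
      ∀ (m : ℕ), 1 ≤ m → ∀ (V : Fin m → Set X) (U : Fin ℓ → Fin m → Set X),
        (∀ j, IsOpen (V j)) → (∀ j, (V j ∩ E).Nonempty) →
        (∀ i j, IsOpen (U i j)) → (∀ i j, (U i j ∩ E).Nonempty) →
        (⋂ j, hittingTimes (⇑T) a (V j ∩ E) (fun i => U i j)).Nonempty := by
  constructor
  · intro h m hm V U hV hVE hU hUE
    obtain ⟨A, hA, hAE⟩ := h m hm
    have hF : IsClosed {y : Fin m → X | ∀ j, y j ∈ E} := by
      simp only [Set.ofPred_forall]
      exact isClosed_iInter fun j => hE.preimage (continuous_apply j)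
    have : CompactSpace {y : Fin m → X | ∀ j, y j ∈ E} :=
      isCompact_iff_compactSpace.1 hF.isCompact
    choose v hv using hVE
    choose u hu using hUE
    have hW : IsOpen {x : {y : Fin m → X | ∀ j, y j ∈ E} | ∀ j, (x : Fin m → X) j ∈ V j} := by
      simp only [Set.ofPred_forall]
      exact isOpen_iInter_of_finite fun j =>
        (hV j).preimage ((continuous_apply j).comp continuous_subtype_val)
    obtain ⟨x, hxV, hxA⟩ := (dense_of_mem_residual hA).inter_open_nonempty _ hW
      ⟨⟨v, fun j => (hv j).2⟩, fun j => (hv j).1⟩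
    have hO : IsOpen {y : Fin ℓ → Fin m → X | ∀ i j, y i j ∈ U i j} := by
      simp only [Set.ofPred_forall]
      exact isOpen_iInter_of_finite fun i => isOpen_iInter_of_finite fun j =>
        (hU i j).preimage ((continuous_apply j).comp (continuous_apply i))
    obtain ⟨_, hyU, n, hn, rfl⟩ := mem_closure_iff.1
      (hAE x hxA (show u ∈ _ from fun i j => (hu i j).2)) _ hO fun i j => (hu i j).1
    refine ⟨n, Set.mem_iInter.2 fun j => ⟨hn, (x : Fin m → X) j, ⟨hxV j, x.2 j⟩,
      Set.mem_iInter.2 fun i => ?_⟩⟩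
    have hU' : ((fun y : Fin m → X => T ∘ y)^[a i n] x) j ∈ U i j := hyU i j
    rwa [iterate_comp_left_apply] at hU'
  · intro h m hm
    refine deltaTransAlong_of_hittingTimes_nonempty
      (continuous_pi fun j => T.continuous.comp (continuous_apply j)) a _ ?_
    rintro V U hV ⟨v, hvV, hvE⟩ hU hUE
    choose u hu huE using hUE
    obtain ⟨V', hV', hV'V⟩ := isOpen_pi_iff'.1 hV v hvV
    choose U' hU' hU'U using fun i => isOpen_pi_iff'.1 (hU i) (u i) (hu i)
    obtain ⟨n, hn⟩ := h m hm V' U' (fun j => (hV' j).1) (fun j => ⟨v j, (hV' j).2, hvE j⟩)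
      (fun i j => (hU' i j).1) (fun i j => ⟨u i j, (hU' i j).2, huE i j⟩)
    choose hn1 x hx hxU using Set.mem_iInter.1 hn
    refine ⟨n, hn1 ⟨0, hm⟩, x, ⟨hV'V fun j _ => (hx j).1, fun j => (hx j).2⟩,
      Set.mem_iInter.2 fun i => ?_⟩
    change (fun y : Fin m → X => T ∘ y)^[a i n] x ∈ U i
    rw [iterate_comp_left_apply]
    exact hU'U i fun j _ => Set.mem_iInter.1 (hxU j) i
end
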